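/- arXiv:2512.08554 — 4 statements merged into one kernel-verified Lean document; each statement's English description precedes it below -/
import Mathlib

section
/- Let G be a finite simple chordal graph. Then the induced path polytope of G equals the set of (x,y) ∈ R^V × R^E satisfying Σ_{v∈V} x_v − Σ_{e∈E} y_e = 1, x ≥ 0, y ≥ 0, and the inequality Σ_{u ∈ C_G(K∪{w})} y_{wu} + 2 Σ_{u ∈ K} y_{wu} ≤ 2 x_w for every vertex w and every clique K ⊆ N(w) that defines an orbit of w (i.e., the inequalities associated with non-orbit-defining cliques may be omitted). -/
open SimpleGraph Finset
open scoped Classical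

/-- A graph has a hole if some set of vertices induces a cycle of length at least 4. -/
def SimpleGraph.HasHole {V : Type*} (G : SimpleGraph V) : Prop :=
  ∃ (W : Set V) (n : ℕ), 4 ≤ n ∧ Nonempty (G.induce W ≃g SimpleGraph.cycleGraph n)

/-- A graph is chordal if it has no hole. -/
def SimpleGraph.Chordal {V : Type*} (G : SimpleGraph V) : Prop := ¬ G.HasHole

/-- `W` induces a tree in `G`. -/
def SimpleGraph.IsInducedTree {V : Type*} (G : SimpleGraph V) (W : Finset V) : Prop :=
  (G.induce (W : Set V)).IsTree

/-- `W` induces a path in `G`. -/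
def SimpleGraph.IsInducedPath {V : Type*} (G : SimpleGraph V) (W : Finset V) : Prop :=
  ∃ n : ℕ, 1 ≤ n ∧ Nonempty (G.induce (W : Set V) ≃g SimpleGraph.pathGraph n)

/-- The extended incidence vector of a vertex set `W`. -/
noncomputable def SimpleGraph.xi {V : Type*} (G : SimpleGraph V) (W : Finset V) :
    (V → ℝ) × (Sym2 V → ℝ) :=
  (fun v => if v ∈ W then 1 else 0,
   fun e => if e ∈ G.edgeSet ∧ ∀ v ∈ e, v ∈ W then 1 else 0)

/-- `K` is a maximal clique of `G`. -/
def SimpleGraph.IsMaxCliqueF {V : Type*} (G : SimpleGraph V) (K : Finset V) : Prop :=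
  G.IsClique (K : Set V) ∧ ∀ K' : Finset V, G.IsClique (K' : Set V) → K ⊆ K' → K' = K

/-- The induced tree cone `C_T(G)`. -/
noncomputable def SimpleGraph.inducedTreeCone {V : Type*} (G : SimpleGraph V) :
    Set ((V → ℝ) × (Sym2 V → ℝ)) :=
  {p | (∀ v, 0 ≤ p.1 v) ∧ (∀ e, 0 ≤ p.2 e) ∧ (∀ e, e ∉ G.edgeSet → p.2 e = 0) ∧
    ∀ (v : V) (K : Finset V), G.IsMaxCliqueF K → v ∈ K →
      ∑ u ∈ K.erase v, p.2 s(u, v) ≤ p.1 v}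

/-- The set of vertices outside `S` complete to `S`. -/
noncomputable def SimpleGraph.completeTo {V : Type*} [Fintype V] (G : SimpleGraph V)
    (S : Finset V) : Finset V :=
  Finset.univ.filter fun v => v ∉ S ∧ ∀ u ∈ S, G.Adj v u

/-- The induced path cone `C_P(G)`. -/
noncomputable def SimpleGraph.inducedPathCone {V : Type*} [Fintype V] (G : SimpleGraph V) :
    Set ((V → ℝ) × (Sym2 V → ℝ)) :=
  {p | (∀ v, 0 ≤ p.1 v) ∧ (∀ e, 0 ≤ p.2 e) ∧ (∀ e, e ∉ G.edgeSet → p.2 e = 0) ∧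
    ∀ (w : V) (K : Finset V), (K : Set V) ⊆ G.neighborSet w → G.IsClique (K : Set V) →
      ∑ u ∈ G.completeTo (insert w K), p.2 s(w, u) + 2 * ∑ u ∈ K, p.2 s(w, u) ≤ 2 * p.1 w}

/-- The polytope `T(G)`: intersection of `C_T(G)` with the hyperplane `x(V) - y(E) = 1`. -/
noncomputable def SimpleGraph.treePolyT {V : Type*} [Fintype V] (G : SimpleGraph V) :
    Set ((V → ℝ) × (Sym2 V → ℝ)) :=
  {p ∈ G.inducedTreeCone | ∑ v : V, p.1 v - ∑ e : Sym2 V, p.2 e = 1}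

/-- The polytope `P(G)`: intersection of `C_P(G)` with the hyperplane `x(V) - y(E) = 1`. -/
noncomputable def SimpleGraph.pathPolyP {V : Type*} [Fintype V] (G : SimpleGraph V) :
    Set ((V → ℝ) × (Sym2 V → ℝ)) :=
  {p ∈ G.inducedPathCone | ∑ v : V, p.1 v - ∑ e : Sym2 V, p.2 e = 1}

/-- The induced tree polytope: convex hull of extended incidence vectors of induced trees. -/
noncomputable def SimpleGraph.inducedTreePolytope {V : Type*} (G : SimpleGraph V) :
    Set ((V → ℝ) × (Sym2 V → ℝ)) :=
  convexHull ℝ {p | ∃ W : Finset V, G.IsInducedTree W ∧ p = G.xi W}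

/-- The induced path polytope: convex hull of extended incidence vectors of induced paths. -/
noncomputable def SimpleGraph.inducedPathPolytope {V : Type*} (G : SimpleGraph V) :
    Set ((V → ℝ) × (Sym2 V → ℝ)) :=
  convexHull ℝ {p | ∃ W : Finset V, G.IsInducedPath W ∧ p = G.xi W}

/-- `p` is an extreme point of `s`: it cannot be written as the midpoint of two
distinct points of `s`. -/
def IsExtremePt {E : Type*} [AddCommGroup E] [Module ℝ E] (s : Set E) (p : E) : Prop :=
  p ∈ s ∧ ∀ q r : E, q ∈ s → r ∈ s → p = (2⁻¹ : ℝ) • (q + r) → q = r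

/-- `u` is an extremity of the induced path `W` (degree at most 1 in the induced subgraph). -/
noncomputable def SimpleGraph.IsExtremity {V : Type*} (G : SimpleGraph V) (u : V)
    (W : Finset V) : Prop :=
  u ∈ W ∧ (W.filter fun w => G.Adj u w).card ≤ 1

/-- The neighborhood of `v` as a `Finset`. -/
noncomputable def SimpleGraph.nbrF {V : Type*} [Fintype V] (G : SimpleGraph V) (v : V) :
    Finset V :=
  Finset.univ.filter fun u => G.Adj v u

/-- `K` defines an orbit of `w`. -/
noncomputable def SimpleGraph.DefinesOrbit {V : Type*} [Fintype V] (G : SimpleGraph V)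
    (w : V) (K : Finset V) : Prop :=
  (K : Set V) ⊆ G.neighborSet w ∧ G.IsClique (K : Set V) ∧
    ¬ ∃ K' : Finset V, (K' : Set V) ⊆ G.neighborSet w ∧ G.IsClique (K' : Set V) ∧ K ⊂ K' ∧
      insert w K ∪ G.completeTo (insert w K) ⊆ insert w K' ∪ G.completeTo (insert w K')

section Cone

variable {E ι : Type*} [AddCommGroup E] [Module ℝ E]

/-- Decomposition of a point of a polyhedral cone into generators, provided that every nonzero
point of the cone has a generator in its minimal face. -/
theorem exists_smul_convexHull_of_exists_face_generator [Fintype ι] (l : ι → E → ℝ) (S : Set E)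
    (hl : ∀ i p s, ∀ ε : ℝ, l i (p - ε • s) = l i p - ε * l i s)
    (hS : ∀ s ∈ S, ∀ i, 0 ≤ l i s)
    (hface : ∀ p, (∀ i, 0 ≤ l i p) → p ≠ 0 →
      ∃ s ∈ S, (∀ i, l i p = 0 → l i s = 0) ∧ ∃ i, 0 < l i s)
    (p : E) (hp : ∀ i, 0 ≤ l i p) :
    p = 0 ∨ ∃ t : ℝ, 0 < t ∧ ∃ q ∈ convexHull ℝ S, p = t • q := by
  induction hn : (univ.filter fun i => l i p ≠ 0).card using Nat.strong_induction_on
    generalizing p with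
  | _ n ih =>
  by_cases h0 : p = 0
  · exact Or.inl h0
  right
  obtain ⟨s, hs, htight, i₀, hi₀⟩ := hface p hp h0
  obtain ⟨j, hj, hmin⟩ := (univ.filter fun i => 0 < l i s).exists_min_image
    (fun i => l i p / l i s) ⟨i₀, by simpa using hi₀⟩
  have hjs : 0 < l j s := by simpa using hj
  have hjp : 0 < l j p := lt_of_le_of_ne (hp j) fun h => hjs.ne' (htight j h.symm)
  set ε := l j p / l j s with hε
  have hεpos : 0 < ε := div_pos hjp hjs
  have hcone : ∀ i, 0 ≤ l i (p - ε • s) := by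
    intro i
    rw [hl]
    rcases (hS s hs i).eq_or_lt with h | h
    · rw [← h]; simpa using hp i
    · have := hmin i (by simpa using h)
      rw [le_div_iff₀ h] at this
      linarith
  have hlt : (univ.filter fun i => l i (p - ε • s) ≠ 0).card < n := by
    rw [← hn]
    apply Finset.card_lt_card
    rw [Finset.ssubset_iff_of_subset]
    · refine ⟨j, by simpa using hjp.ne', ?_⟩
      simp [hl, hε, hjs.ne']
    · intro i
      simp only [mem_filter, mem_univ, true_and, hl]
      intro h h'
      exact h (by rw [h', htight i h']; ring)
  rcases ih _ hlt (p - ε • s) hcone rfl with h | ⟨t, ht, q, hq, h⟩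
  · exact ⟨ε, hεpos, s, subset_convexHull ℝ S hs, sub_eq_zero.1 h⟩
  · have hsum : 0 < ε + t := by positivity
    refine ⟨ε + t, hsum, (ε / (ε + t)) • s + (t / (ε + t)) • q,
      convex_convexHull ℝ S (subset_convexHull ℝ S hs) hq (by positivity) (by positivity)
        (by field_simp), ?_⟩
    rw [smul_add, smul_smul, smul_smul, mul_div_cancel₀ _ hsum.ne', mul_div_cancel₀ _ hsum.ne',
      ← h]
    abel

end Cone

/-- If every biclique `(A, B)` of `R` inside `N` has weight at most `c`, then an element `u` of
positive weight either lies in the first side of every biclique of weight `c`, or has an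
`R`-unrelated partner such that each biclique of weight `c` is hit by the pair. -/
theorem exists_partner_of_biclique_le {V : Type*} (R : V → V → Prop) (N : Finset V) (y : V → ℝ)
    (c : ℝ) (hy : ∀ u, 0 ≤ y u)
    (hle : ∀ A B : Finset V, A ⊆ N → B ⊆ N → (∀ a ∈ A, ∀ b ∈ B, R a b) →
      ∑ a ∈ A, y a + ∑ b ∈ B, y b ≤ c)
    {u : V} (huN : u ∈ N) (hu : 0 < y u) :
    (∀ A B : Finset V, A ⊆ N → B ⊆ N → (∀ a ∈ A, ∀ b ∈ B, R a b) →
      ∑ a ∈ A, y a + ∑ b ∈ B, y b = c → u ∈ A) ∨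
    ∃ u' ∈ N, 0 < y u' ∧ ¬ R u u' ∧
      ∀ A B : Finset V, A ⊆ N → B ⊆ N → (∀ a ∈ A, ∀ b ∈ B, R a b) →
        ∑ a ∈ A, y a + ∑ b ∈ B, y b = c → u ∈ A ∨ u' ∈ B := by
  by_cases hall : ∀ A B : Finset V, A ⊆ N → B ⊆ N → (∀ a ∈ A, ∀ b ∈ B, R a b) →
      ∑ a ∈ A, y a + ∑ b ∈ B, y b = c → u ∈ A
  · exact Or.inl hall
  right
  let P : ℕ → Prop := fun n => ∃ A B : Finset V, A ⊆ N ∧ B ⊆ N ∧ (∀ a ∈ A, ∀ b ∈ B, R a b) ∧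
    ∑ a ∈ A, y a + ∑ b ∈ B, y b = c ∧ u ∉ A ∧ B.card = n
  have hP : ∃ n, P n := by
    push Not at hall
    obtain ⟨A, B, hA, hB, hR, hc, hu⟩ := hall
    exact ⟨_, A, B, hA, hB, hR, hc, hu, rfl⟩
  obtain ⟨A, B, hA, hB, hR, hc, huA, hcard⟩ := Nat.find_spec hP
  have hBmin : ∀ A' B' : Finset V, A' ⊆ N → B' ⊆ N → (∀ a ∈ A', ∀ b ∈ B', R a b) →
      ∑ a ∈ A', y a + ∑ b ∈ B', y b = c → u ∉ A' → B ⊆ B' := by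
    intro A' B' hA' hB' hR' hc' huA'
    have h1 : ∑ a ∈ A ∪ A', y a + ∑ b ∈ B ∩ B', y b ≤ c :=
      hle _ _ (union_subset hA hA') (inter_subset_left.trans hB) (by grind)
    have h2 : ∑ a ∈ A ∩ A', y a + ∑ b ∈ B ∪ B', y b ≤ c :=
      hle _ _ (inter_subset_left.trans hA) (union_subset hB hB') (by grind)
    have h3 := sum_union_inter (s₁ := A) (s₂ := A') (f := y)
    have h4 := sum_union_inter (s₁ := B) (s₂ := B') (f := y)
    have h5 : P (B ∩ B').card := ⟨A ∪ A', B ∩ B', union_subset hA hA',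
      inter_subset_left.trans hB, by grind, by linarith, by grind, rfl⟩
    have h6 := Nat.find_min' hP h5
    rw [← hcard] at h6
    exact inter_eq_left.1 (eq_of_subset_of_card_le inter_subset_left h6)
  by_contra! hno
  have hB' : ∀ b ∈ B.filter fun b => 0 < y b, R u b := by
    intro b hb
    rw [mem_filter] at hb
    by_contra hRb
    obtain ⟨A', B', hA', hB', hR', hc', huA', hbB'⟩ := hno b (hB hb.1) hb.2 hRb
    exact hbB' (hBmin A' B' hA' hB' hR' hc' huA' hb.1)
  have h1 := hle (insert u A) (B.filter fun b => 0 < y b) (insert_subset huN hA)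
    ((filter_subset _ _).trans hB) (by
      intro a ha b hb
      rcases mem_insert.1 ha with rfl | ha
      · exact hB' b hb
      · exact hR a ha b (mem_filter.1 hb).1)
  rw [sum_insert huA] at h1
  have h2 : ∑ b ∈ B.filter (fun b => 0 < y b), y b = ∑ b ∈ B, y b :=
    sum_filter_of_ne fun b _ hb => lt_of_le_of_ne (hy b) hb.symm
  linarith

namespace SimpleGraph

variable {V : Type*} {G : SimpleGraph V}

/-- In a chordal graph, a walk whose vertices at distance two are distinct and nonadjacent is an
induced path. -/
theorem Chordal.ne_and_adj_imp_of_locally_induced (hG : G.Chordal) {n : ℕ} {v : ℕ → V}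
    (hadj : ∀ i < n, G.Adj (v i) (v (i + 1)))
    (hne : ∀ i, i + 2 ≤ n → v i ≠ v (i + 2) ∧ ¬ G.Adj (v i) (v (i + 2)))
    {i j : ℕ} (hij : i < j) (hj : j ≤ n) :
    v i ≠ v j ∧ (G.Adj (v i) (v j) → j = i + 1) := by
  induction hd : j - i using Nat.strong_induction_on generalizing i j with
  | _ d ih =>
  obtain rfl | rfl | h3 : j = i + 1 ∨ j = i + 2 ∨ i + 3 ≤ j := by omega
  · exact ⟨(hadj i hj).ne, fun _ => rfl⟩
  · exact ⟨(hne i hj).1, fun h => absurd h (hne i hj).2⟩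
  constructor
  · intro h
    have h1 := (hadj i (by omega)).symm
    rw [h] at h1
    have := (ih (j - (i + 1)) (by omega) (by omega) hj rfl).2 h1
    omega
  · intro h
    exfalso
    have hsmall : ∀ a b, a < b → b ≤ d → b - a < d →
        v (i + a) ≠ v (i + b) ∧ (G.Adj (v (i + a)) (v (i + b)) → b = a + 1) := by
      intro a b hab hb hbd
      have := ih (i + b - (i + a)) (by omega) (i := i + a) (j := i + b) (by omega) (by omega) rfl
      exact ⟨this.1, fun h => by have := this.2 h; omega⟩
    have hends : v (i + 0) ≠ v (i + d) := by
      rw [show i + d = j by omega]; exact h.ne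
    have hinj' : ∀ a b, a < b → b ≤ d → v (i + a) ≠ v (i + b) := by
      intro a b hab hb
      by_cases hbd : b - a < d
      · exact (hsmall a b hab hb hbd).1
      · obtain rfl : a = 0 := by omega
        obtain rfl : b = d := by omega
        exact hends
    have hinj : ∀ a b, a ≤ d → b ≤ d → v (i + a) = v (i + b) → a = b := by
      intro a b ha hb hab
      by_contra hne
      rcases Nat.lt_or_gt_of_ne hne with hlt | hlt
      · exact hinj' a b hlt hb hab
      · exact hinj' b a hlt ha hab.symm
    have hadj' : ∀ a b, a < b → b ≤ d →
        (G.Adj (v (i + a)) (v (i + b)) ↔ b = a + 1 ∨ (a = 0 ∧ b = d)) := by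
      intro a b hab hb
      constructor
      · intro hA
        by_cases hbd : b - a < d
        · exact Or.inl ((hsmall a b hab hb hbd).2 hA)
        · right; omega
      · rintro (rfl | ⟨rfl, rfl⟩)
        · exact hadj _ (by omega)
        · rw [show i + b = j by omega]; exact h
    let f : Fin (d + 1) → V := fun k => v (i + k)
    have hf : Function.Injective f := fun a b hab =>
      Fin.ext (hinj a b (by omega) (by omega) hab)
    have key : ∀ a b : Fin (d + 1), a < b →
        (G.Adj (f a) (f b) ↔ (cycleGraph (d + 1)).Adj a b) := by
      intro a b hab
      rw [cycleGraph_adj', Fin.sub_val_of_le hab.le, Fin.coe_sub_iff_lt.2 hab,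
        hadj' a b hab (by omega)]
      have := Fin.lt_def.1 hab
      omega
    refine hG ⟨Set.range f, d + 1, by omega, ⟨RelIso.symm ⟨Equiv.ofInjective f hf, ?_⟩⟩⟩
    intro a b
    simp only [comap_adj, Function.Embedding.subtype_apply, Equiv.ofInjective_apply]
    rcases lt_trichotomy a b with hab | rfl | hab
    · exact key a b hab
    · simp
    · rw [G.adj_comm, (cycleGraph _).adj_comm]; exact key b a hab

/-- The vertices of a walk as in `Chordal.ne_and_adj_imp_of_locally_induced` form an induced
path. -/
theorem Chordal.isInducedPath_image (hG : G.Chordal) {n : ℕ} {v : ℕ → V}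
    (hadj : ∀ i < n, G.Adj (v i) (v (i + 1)))
    (hne : ∀ i, i + 2 ≤ n → v i ≠ v (i + 2) ∧ ¬ G.Adj (v i) (v (i + 2))) :
    G.IsInducedPath ((range (n + 1)).image v) := by
  have H := fun {i j : ℕ} => hG.ne_and_adj_imp_of_locally_induced hadj hne (i := i) (j := j)
  let f : Fin (n + 1) → (((range (n + 1)).image v : Finset V) : Set V) :=
    fun k => ⟨v k, by simpa using ⟨k, by omega, rfl⟩⟩
  have hf : Function.Bijective f := by
    constructor
    · intro a b hab
      have hab' : v a = v b := congrArg Subtype.val hab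
      rcases lt_trichotomy a b with h | h | h
      · exact absurd hab' (H h (by omega)).1
      · exact h
      · exact absurd hab'.symm (H h (by omega)).1
    · rintro ⟨w, hw⟩
      obtain ⟨k, hk, rfl⟩ : ∃ k < n + 1, v k = w := by simpa using hw
      exact ⟨⟨k, hk⟩, rfl⟩
  have key : ∀ a b : Fin (n + 1), a < b →
      (G.Adj (v a) (v b) ↔ (pathGraph (n + 1)).Adj a b) := by
    intro a b hab
    rw [pathGraph_adj]
    have hlt := Fin.lt_def.1 hab
    constructor
    · intro h
      exact Or.inl ((H hab (by omega)).2 h).symm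
    · rintro (h | h)
      · rw [← h]; exact hadj _ (by omega)
      · omega
  refine ⟨n + 1, by omega, ⟨RelIso.symm ⟨Equiv.ofBijective f hf, ?_⟩⟩⟩
  intro a b
  simp only [comap_adj, Function.Embedding.subtype_apply, Equiv.ofBijective_apply, f]
  rcases lt_trichotomy a b with hab | rfl | hab
  · exact key a b hab
  · simp
  · rw [G.adj_comm, (pathGraph _).adj_comm]; exact key b a hab

/-- An induced path can be enumerated. -/
theorem IsInducedPath.exists_enum {W : Finset V} (hW : G.IsInducedPath W) :
    ∃ (n : ℕ) (v : Fin (n + 1) → V), Function.Injective v ∧ (∀ w, w ∈ W ↔ ∃ i, v i = w) ∧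
      ∀ i j, G.Adj (v i) (v j) ↔ i.val + 1 = j.val ∨ j.val + 1 = i.val := by
  obtain ⟨n, hn, ⟨φ⟩⟩ := hW
  obtain ⟨n, rfl⟩ := Nat.exists_eq_add_of_le' hn
  refine ⟨n, fun i => (φ.symm i).1, fun i j h => φ.symm.injective (Subtype.ext h), ?_, ?_⟩
  · intro w
    constructor
    · intro hw
      exact ⟨φ ⟨w, hw⟩, by simp⟩
    · rintro ⟨i, rfl⟩
      exact (φ.symm i).2
  · intro i j
    rw [← pathGraph_adj, ← φ.symm.map_adj_iff]
    rfl

theorem xi_snd_mk (W : Finset V) (a b : V) :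
    (G.xi W).2 s(a, b) = if G.Adj a b ∧ a ∈ W ∧ b ∈ W then 1 else 0 := by
  simp [xi]

theorem xi_fst_nonneg (W : Finset V) (v : V) : 0 ≤ (G.xi W).1 v := by
  simp only [xi]; split_ifs <;> simp

theorem xi_snd_nonneg (W : Finset V) (e : Sym2 V) : 0 ≤ (G.xi W).2 e := by
  simp only [xi]; split_ifs <;> simp

theorem xi_snd_eq_zero (W : Finset V) {e : Sym2 V} (he : e ∉ G.edgeSet) : (G.xi W).2 e = 0 := by
  simp [xi, he]

variable [Fintype V]

theorem IsInducedPath.sum_xi {W : Finset V} (hW : G.IsInducedPath W) :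
    ∑ v, (G.xi W).1 v - ∑ e, (G.xi W).2 e = 1 := by
  obtain ⟨n, v, hinj, hmem, hadj⟩ := hW.exists_enum
  have h1 : W = univ.image v := by ext w; simp [hmem]
  have h2 : (univ.filter fun e => e ∈ G.edgeSet ∧ ∀ v ∈ e, v ∈ W) =
      univ.image fun i : Fin n => s(v i.castSucc, v i.succ) := by
    ext e
    induction e with
    | _ a b =>
    simp only [mem_filter, mem_univ, true_and, mem_edgeSet, Sym2.mem_iff, forall_eq_or_imp,
      forall_eq, mem_image, hmem]
    constructor
    · rintro ⟨hA, ⟨i, rfl⟩, ⟨j, rfl⟩⟩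
      rcases (hadj i j).1 hA with h | h
      · refine ⟨⟨i, by omega⟩, ?_⟩
        congr 2
        exact Fin.ext h
      · refine ⟨⟨j, by omega⟩, ?_⟩
        rw [Sym2.eq_swap]
        congr 2
        exact Fin.ext h
    · rintro ⟨i, hi⟩
      rcases Sym2.eq_iff.1 hi with ⟨rfl, rfl⟩ | ⟨rfl, rfl⟩
      · exact ⟨by simp [hadj], ⟨_, rfl⟩, ⟨_, rfl⟩⟩
      · exact ⟨by simp [hadj], ⟨_, rfl⟩, ⟨_, rfl⟩⟩
  have h3 : Function.Injective fun i : Fin n => s(v i.castSucc, v i.succ) := by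
    intro i j h
    rcases Sym2.eq_iff.1 h with ⟨h, -⟩ | ⟨h, h'⟩
    · exact Fin.castSucc_injective _ (hinj h)
    · have := congrArg Fin.val (hinj h)
      have := congrArg Fin.val (hinj h')
      simp at *
      omega
  have h4 : ∑ e, (G.xi W).2 e = n := by
    have : ∑ e, (G.xi W).2 e =
        ∑ e ∈ univ.filter (fun e => e ∈ G.edgeSet ∧ ∀ v ∈ e, v ∈ W), 1 := by
      rw [sum_filter]
      exact sum_congr rfl fun e _ => by simp only [xi]; congr
    rw [this, h2, sum_const, card_image_of_injective _ h3]
    simp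
  have h5 : ∑ w, (G.xi W).1 w = n + 1 := by
    simp only [xi, sum_boole]
    rw [filter_mem_eq_inter, univ_inter, h1, card_image_of_injective _ hinj]
    simp
  rw [h4, h5]
  ring

/-- The coefficient of the edge `s(w, u)` in the inequality given by the clique `K ⊆ N(w)`. -/
noncomputable def orbitCoeff (G : SimpleGraph V) (w : V) (K : Finset V) (u : V) : ℝ :=
  (if u ∈ G.completeTo (insert w K) then 1 else 0) + 2 * if u ∈ K then 1 else 0

theorem sum_completeTo_add_eq (w : V) (K : Finset V) (f : V → ℝ) :
    ∑ u ∈ G.completeTo (insert w K), f u + 2 * ∑ u ∈ K, f u =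
      ∑ u, G.orbitCoeff w K u * f u := by
  simp only [orbitCoeff, add_mul, sum_add_distrib, mul_assoc, ← mul_sum, ite_mul, one_mul,
    zero_mul, sum_ite_mem, univ_inter]

theorem mem_completeTo_insert {w u : V} {K : Finset V} :
    u ∈ G.completeTo (insert w K) ↔ G.Adj w u ∧ u ∉ K ∧ ∀ a ∈ K, G.Adj u a := by
  simp only [completeTo, mem_filter, mem_univ, true_and, mem_insert, forall_eq_or_imp, not_or]
  exact ⟨fun h => ⟨h.2.1.symm, h.1.2, h.2.2⟩, fun h => ⟨⟨h.1.ne', h.2.1⟩, h.1.symm, h.2.2⟩⟩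

theorem orbitCoeff_nonneg (w : V) (K : Finset V) (u : V) : 0 ≤ G.orbitCoeff w K u := by
  unfold orbitCoeff; split_ifs <;> norm_num

theorem orbitCoeff_of_mem {w u : V} {K : Finset V} (hu : u ∈ K) : G.orbitCoeff w K u = 2 := by
  simp [orbitCoeff, mem_completeTo_insert, hu]

theorem orbitCoeff_le_two (w : V) (K : Finset V) (u : V) : G.orbitCoeff w K u ≤ 2 := by
  by_cases hu : u ∈ K
  · exact (orbitCoeff_of_mem hu).le
  · simp only [orbitCoeff, hu, if_false]; split_ifs <;> norm_num

theorem orbitCoeff_add_le_two {w a b : V} {K : Finset V} (hK : G.IsClique (K : Set V))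
    (hab : a ≠ b) (hadj : ¬ G.Adj a b) : G.orbitCoeff w K a + G.orbitCoeff w K b ≤ 2 := by
  have h1 : a ∈ K → b ∉ K := fun ha hb => hadj (hK ha hb hab)
  have h2 : a ∈ K → b ∉ G.completeTo (insert w K) := fun ha hb =>
    hadj ((mem_completeTo_insert.1 hb).2.2 a ha).symm
  have h3 : b ∈ K → a ∉ G.completeTo (insert w K) := fun hb ha =>
    hadj ((mem_completeTo_insert.1 ha).2.2 b hb)
  unfold orbitCoeff
  split_ifs <;> norm_num
  all_goals simp_all [mem_completeTo_insert]

theorem IsInducedPath.sum_orbitCoeff_le {W : Finset V} (hW : G.IsInducedPath W) (w : V)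
    {K : Finset V} (hK : G.IsClique (K : Set V)) :
    ∑ u, G.orbitCoeff w K u * (G.xi W).2 s(w, u) ≤ 2 * (G.xi W).1 w := by
  by_cases hw : w ∈ W
  swap
  · simp [xi, hw]
  have hsum : ∑ u, G.orbitCoeff w K u * (G.xi W).2 s(w, u) =
      ∑ u ∈ W.filter (G.Adj w), G.orbitCoeff w K u := by
    have : W.filter (G.Adj w) = univ.filter fun u => G.Adj w u ∧ u ∈ W := by
      ext u; simp [and_comm]
    rw [this, sum_filter]
    exact sum_congr rfl fun u _ => by simp [xi_snd_mk, hw]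
  rw [hsum]
  have hx : (G.xi W).1 w = 1 := by simp [xi, hw]
  rw [hx, mul_one]
  obtain ⟨n, v, hinj, hmem, hadj⟩ := hW.exists_enum
  obtain ⟨k, rfl⟩ := (hmem w).1 hw
  have hnadj : ∀ a ∈ W.filter (G.Adj (v k)), ∀ b ∈ W.filter (G.Adj (v k)), ¬ G.Adj a b := by
    intro a ha b hb
    simp only [mem_filter, hmem] at ha hb
    obtain ⟨⟨i, rfl⟩, hi⟩ := ha
    obtain ⟨⟨j, rfl⟩, hj⟩ := hb
    rw [hadj] at hi hj ⊢
    omega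
  have hcard : (W.filter (G.Adj (v k))).card ≤ 2 := by
    by_contra! h
    obtain ⟨a, ha, b, hb, c, hc, hab, hac, hbc⟩ := two_lt_card.1 h
    simp only [mem_filter, hmem] at ha hb hc
    obtain ⟨⟨i, rfl⟩, hi⟩ := ha
    obtain ⟨⟨j, rfl⟩, hj⟩ := hb
    obtain ⟨⟨l, rfl⟩, hl⟩ := hc
    rw [hadj] at hi hj hl
    have h1 : i.val ≠ j.val := fun h => hab (congrArg v (Fin.ext h))
    have h2 : i.val ≠ l.val := fun h => hac (congrArg v (Fin.ext h))
    have h3 : j.val ≠ l.val := fun h => hbc (congrArg v (Fin.ext h))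
    omega
  generalize W.filter (G.Adj (v k)) = N at hnadj hcard
  obtain h | h | h : N.card = 0 ∨ N.card = 1 ∨ N.card = 2 := by omega
  · rw [card_eq_zero.1 h]; norm_num
  · obtain ⟨a, rfl⟩ := card_eq_one.1 h
    simpa using orbitCoeff_le_two _ _ _
  · obtain ⟨a, b, hab, rfl⟩ := card_eq_two.1 h
    rw [sum_pair hab]
    exact orbitCoeff_add_le_two hK hab (hnadj a (by simp) b (by simp))

end SimpleGraph

/-- Following a partial extension rule for the steps of a walk either goes on forever or reaches
a final step. -/
theorem exists_infinite_or_finished_walk {V : Type*} (Q D : V → V → Prop) (T : V → V → V → Prop)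
    (hstep : ∀ a b, Q a b → D a b ∨ ∃ c, Q b c ∧ T a b c) {a b : V} (hab : Q a b) :
    ∃ v : ℕ → V, v 0 = a ∧ v 1 = b ∧
      ((∀ i, Q (v i) (v (i + 1)) ∧ T (v i) (v (i + 1)) (v (i + 2))) ∨
        ∃ n, (∀ i ≤ n, Q (v i) (v (i + 1))) ∧ (∀ i < n, T (v i) (v (i + 1)) (v (i + 2))) ∧
          D (v n) (v (n + 1))) := by
  have hnext : ∀ a b, ∃ c, Q a b → ¬ D a b → Q b c ∧ T a b c := by
    intro a b
    by_cases h : ∃ c, Q b c ∧ T a b c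
    · obtain ⟨c, hc⟩ := h
      exact ⟨c, fun _ _ => hc⟩
    · exact ⟨a, fun hQ hD => ((hstep a b hQ).resolve_left hD |> h).elim⟩
  choose next hnext using hnext
  let s : ℕ → V × V := fun n => (fun q : V × V => (q.2, next q.1 q.2))^[n] (a, b)
  have hs : ∀ n, s (n + 1) = ((s n).2, next (s n).1 (s n).2) := fun n =>
    Function.iterate_succ_apply' _ _ _
  let v : ℕ → V := fun n => (s n).1
  have hv1 : ∀ n, v (n + 1) = (s n).2 := fun n => by simp only [v, hs]
  have hv2 : ∀ n, v (n + 2) = next (v n) (v (n + 1)) := fun n => by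
    rw [hv1 (n + 1), hs, hv1 n]
  have hQ : ∀ n, (∀ i < n, ¬ D (v i) (v (i + 1))) → Q (v n) (v (n + 1)) := by
    intro n
    induction n with
    | zero => exact fun _ => hab
    | succ n ih =>
      intro h
      have := (hnext _ _ (ih fun i hi => h i (by omega)) (h n (by omega))).1
      rwa [← hv2] at this
  have hT : ∀ n, (∀ i < n + 1, ¬ D (v i) (v (i + 1))) → T (v n) (v (n + 1)) (v (n + 2)) := by
    intro n h
    rw [hv2]
    exact (hnext _ _ (hQ n fun i hi => h i (by omega)) (h n (by omega))).2
  refine ⟨v, rfl, rfl, ?_⟩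
  by_cases hD : ∃ n, D (v n) (v (n + 1))
  · right
    refine ⟨Nat.find hD, fun i hi => hQ i fun j hj => Nat.find_min hD (by omega),
      fun i hi => hT i fun j hj => Nat.find_min hD (by omega), Nat.find_spec hD⟩
  · left
    push Not at hD
    exact fun i => ⟨hQ i fun j _ => hD j, hT i fun j _ => hD j⟩

namespace SimpleGraph

variable {V : Type*} [Fintype V] {G : SimpleGraph V}

theorem mem_inducedPathCone_iff {p : (V → ℝ) × (Sym2 V → ℝ)} :
    p ∈ G.inducedPathCone ↔ (∀ v, 0 ≤ p.1 v) ∧ (∀ e, 0 ≤ p.2 e) ∧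
      (∀ e, e ∉ G.edgeSet → p.2 e = 0) ∧
      ∀ (w : V) (K : Finset V), (K : Set V) ⊆ G.neighborSet w → G.IsClique (K : Set V) →
        ∑ u, G.orbitCoeff w K u * p.2 s(w, u) ≤ 2 * p.1 w := by
  simp only [inducedPathCone, Set.mem_ofPred_eq, sum_completeTo_add_eq]

/-- The inequalities of orbit-defining cliques imply those of all cliques. -/
theorem sum_orbitCoeff_le_of_definesOrbit {w : V} {y : V → ℝ} {c : ℝ} (hy : ∀ u, 0 ≤ y u)
    (h : ∀ K : Finset V, G.DefinesOrbit w K → ∑ u, G.orbitCoeff w K u * y u ≤ c)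
    (K : Finset V) (hKw : (K : Set V) ⊆ G.neighborSet w) (hK : G.IsClique (K : Set V)) :
    ∑ u, G.orbitCoeff w K u * y u ≤ c := by
  induction hn : Fintype.card V - K.card using Nat.strong_induction_on generalizing K with
  | _ n ih =>
  by_cases hO : G.DefinesOrbit w K
  · exact h K hO
  obtain ⟨K', hK'w, hK', hss, hsub⟩ : ∃ K' : Finset V, (K' : Set V) ⊆ G.neighborSet w ∧
      G.IsClique (K' : Set V) ∧ K ⊂ K' ∧
      insert w K ∪ G.completeTo (insert w K) ⊆ insert w K' ∪ G.completeTo (insert w K') := by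
    by_contra hno
    exact hO ⟨hKw, hK, hno⟩
  have h1 := card_lt_card hss
  have h2 := card_le_univ K'
  refine le_trans (sum_le_sum fun u _ => mul_le_mul_of_nonneg_right ?_ (hy u))
    (ih _ (by omega) K' hK'w hK' rfl)
  by_cases hu' : u ∈ K'
  · rw [orbitCoeff_of_mem hu']
    exact orbitCoeff_le_two _ _ _
  have hu : u ∉ K := fun hu => hu' (hss.subset hu)
  by_cases hC : u ∈ G.completeTo (insert w K)
  · have hC' : u ∈ G.completeTo (insert w K') := by
      have := hsub (mem_union_right _ hC)
      simp only [mem_union, mem_insert, hu', or_false] at this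
      exact this.resolve_left (mem_completeTo_insert.1 hC).1.ne'
    simp [orbitCoeff, hu, hu', hC, hC']
  · have : G.orbitCoeff w K u = 0 := by simp [orbitCoeff, hu, hC]
    rw [this]
    exact orbitCoeff_nonneg _ _ _

/-- An edge of positive weight at `w` is, or extends to, a local configuration of an induced path
at `w` which satisfies all tight clique inequalities with equality. -/
theorem exists_tight_local_extension {p : (V → ℝ) × (Sym2 V → ℝ)} (hp : p ∈ G.inducedPathCone)
    {u w : V} (hu : 0 < p.2 s(u, w)) :
    (∀ K : Finset V, (K : Set V) ⊆ G.neighborSet w → G.IsClique (K : Set V) →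
      ∑ u, G.orbitCoeff w K u * p.2 s(w, u) = 2 * p.1 w → 2 ≤ G.orbitCoeff w K u) ∨
    ∃ u', 0 < p.2 s(w, u') ∧ (u ≠ u' ∧ ¬ G.Adj u u') ∧
      ∀ K : Finset V, (K : Set V) ⊆ G.neighborSet w → G.IsClique (K : Set V) →
        ∑ u, G.orbitCoeff w K u * p.2 s(w, u) = 2 * p.1 w →
        2 ≤ G.orbitCoeff w K u + G.orbitCoeff w K u' := by
  obtain ⟨-, hy, hE, hineq⟩ := mem_inducedPathCone_iff.1 hp
  have hpair : ∀ K : Finset V,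
      ∑ a ∈ K, p.2 s(w, a) + ∑ a ∈ K ∪ G.completeTo (insert w K), p.2 s(w, a) =
        ∑ a, G.orbitCoeff w K a * p.2 s(w, a) := by
    intro K
    rw [← sum_completeTo_add_eq, sum_union]
    · ring
    · exact Finset.disjoint_left.2 fun a ha hC => (mem_completeTo_insert.1 hC).2.1 ha
  have hbic : ∀ K : Finset V, (K : Set V) ⊆ G.neighborSet w → G.IsClique (K : Set V) →
      K ⊆ univ.filter (G.Adj w) ∧
      K ∪ G.completeTo (insert w K) ⊆ univ.filter (G.Adj w) ∧
      (∀ a ∈ K, ∀ b ∈ K ∪ G.completeTo (insert w K), a = b ∨ G.Adj a b) := by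
    intro K hKw hK
    have h1 : ∀ a ∈ K, G.Adj w a := fun a ha => hKw ha
    refine ⟨fun a ha => by simpa using h1 a ha, fun a ha => ?_, fun a ha b hb => ?_⟩
    · rcases mem_union.1 ha with ha | ha
      · simpa using h1 a ha
      · simpa using (mem_completeTo_insert.1 ha).1
    · rcases mem_union.1 hb with hb | hb
      · exact or_iff_not_imp_left.2 fun hne => hK ha hb hne
      · exact Or.inr ((mem_completeTo_insert.1 hb).2.2 a ha).symm
  have hwu : G.Adj w u := by
    by_contra h
    exact hu.ne' (hE _ (by simpa [G.adj_comm] using h))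
  have key := exists_partner_of_biclique_le (fun a b => a = b ∨ G.Adj a b)
    (univ.filter (G.Adj w)) (fun a => p.2 s(w, a)) (2 * p.1 w) (fun a => hy _) ?_
    (u := u) (by simpa using hwu) (by rwa [Sym2.eq_swap])
  · have hcoef : ∀ (K : Finset V) (a : V), a ∈ K ∪ G.completeTo (insert w K) →
        1 ≤ G.orbitCoeff w K a := by
      intro K a ha
      rcases mem_union.1 ha with ha | ha
      · rw [orbitCoeff_of_mem ha]; norm_num
      · simp only [orbitCoeff, ha]
        split_ifs <;> norm_num
    refine key.imp ?_ ?_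
    · intro h K hKw hK ht
      obtain ⟨h1, h2, h3⟩ := hbic K hKw hK
      rw [orbitCoeff_of_mem (h K _ h1 h2 h3 (by rw [hpair, ht]))]
    · rintro ⟨u', hu'N, hu', hR, h⟩
      refine ⟨u', hu', not_or.1 hR, fun K hKw hK ht => ?_⟩
      obtain ⟨h1, h2, h3⟩ := hbic K hKw hK
      have h4 := h K _ h1 h2 h3 (by rw [hpair, ht])
      have h5 := h _ K h2 h1 (fun a ha b hb => (h3 b hb a ha).imp Eq.symm fun h => h.symm)
        (by rw [add_comm, hpair, ht])
      have n1 := orbitCoeff_nonneg (G := G) w K u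
      have n2 := orbitCoeff_nonneg (G := G) w K u'
      by_cases hu1 : u ∈ K
      · rw [orbitCoeff_of_mem hu1]; linarith
      by_cases hu2 : u' ∈ K
      · rw [orbitCoeff_of_mem hu2]; linarith
      have := hcoef K u (h5.resolve_right hu2)
      have := hcoef K u' (h4.resolve_left hu1)
      linarith
  · intro A B hA hB hAB
    have hKw : ((A ∩ B : Finset V) : Set V) ⊆ G.neighborSet w := by
      intro a ha
      simpa using hA (mem_inter.1 (mem_coe.1 ha)).1
    have hK : G.IsClique ((A ∩ B : Finset V) : Set V) := by
      intro a ha b hb hne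
      exact (hAB a (mem_inter.1 (mem_coe.1 ha)).1 b
        (mem_inter.1 (mem_coe.1 hb)).2).resolve_left hne
    refine le_trans ?_ (hineq w (A ∩ B) hKw hK)
    rw [← hpair, ← sum_union_inter, add_comm]
    refine add_le_add le_rfl (sum_le_sum_of_subset_of_nonneg ?_ fun _ _ _ => hy _)
    intro a ha
    by_cases haK : a ∈ A ∩ B
    · exact mem_union_left _ haK
    refine mem_union_right _ (mem_completeTo_insert.2 ⟨?_, haK, fun b hb => ?_⟩)
    · rcases mem_union.1 ha with ha | ha
      · simpa using hA ha
      · simpa using hB ha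
    · rw [mem_inter] at hb haK
      have hne : a ≠ b := by rintro rfl; exact haK hb
      rcases mem_union.1 ha with ha | ha
      · exact (hAB a ha b hb.2).resolve_left hne
      · exact ((hAB b hb.1 a ha).resolve_left hne.symm).symm

theorem adj_of_mem_inducedPathCone {p : (V → ℝ) × (Sym2 V → ℝ)} (hp : p ∈ G.inducedPathCone)
    {a b : V} (h : 0 < p.2 s(a, b)) : G.Adj a b := by
  by_contra hn
  exact h.ne' (hp.2.2.1 _ hn)

theorem fst_pos_of_mem_inducedPathCone {p : (V → ℝ) × (Sym2 V → ℝ)}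
    (hp : p ∈ G.inducedPathCone) {a b : V} (h : 0 < p.2 s(a, b)) : 0 < p.1 a := by
  have hadj := adj_of_mem_inducedPathCone hp h
  have h1 := (mem_inducedPathCone_iff.1 hp).2.2.2 a ∅ (by simp) (by simp)
  have h2 := single_le_sum (f := fun u => G.orbitCoeff a ∅ u * p.2 s(a, u))
    (fun u _ => mul_nonneg (orbitCoeff_nonneg _ _ _) (hp.2.1 _)) (mem_univ b)
  have h3 : G.orbitCoeff a ∅ b = 1 := by simp [orbitCoeff, completeTo, hadj.ne', hadj.symm]
  simp only [h3, one_mul] at h2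
  linarith

/-- A positive edge weight starts a locally induced walk along positive edges which satisfies the
tight clique inequalities with equality at all vertices but the first. -/
theorem Chordal.exists_tight_walk (hG : G.Chordal) {p : (V → ℝ) × (Sym2 V → ℝ)}
    (hp : p ∈ G.inducedPathCone) {a b : V} (hab : 0 < p.2 s(a, b)) :
    ∃ (v : ℕ → V) (n : ℕ), v 0 = a ∧ v 1 = b ∧ (∀ i ≤ n, 0 < p.2 s(v i, v (i + 1))) ∧
      (∀ i < n, (v i ≠ v (i + 2) ∧ ¬ G.Adj (v i) (v (i + 2))) ∧
        ∀ K : Finset V, (K : Set V) ⊆ G.neighborSet (v (i + 1)) → G.IsClique (K : Set V) →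
          ∑ u, G.orbitCoeff (v (i + 1)) K u * p.2 s(v (i + 1), u) = 2 * p.1 (v (i + 1)) →
          2 ≤ G.orbitCoeff (v (i + 1)) K (v i) + G.orbitCoeff (v (i + 1)) K (v (i + 2))) ∧
      ∀ K : Finset V, (K : Set V) ⊆ G.neighborSet (v (n + 1)) → G.IsClique (K : Set V) →
        ∑ u, G.orbitCoeff (v (n + 1)) K u * p.2 s(v (n + 1), u) = 2 * p.1 (v (n + 1)) →
        2 ≤ G.orbitCoeff (v (n + 1)) K (v n) := by
  obtain ⟨v, h0, h1, h | ⟨n, h2, h3, h4⟩⟩ := exists_infinite_or_finished_walk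
    (fun u w => 0 < p.2 s(u, w))
    (fun u w => ∀ K : Finset V, (K : Set V) ⊆ G.neighborSet w → G.IsClique (K : Set V) →
      ∑ u, G.orbitCoeff w K u * p.2 s(w, u) = 2 * p.1 w → 2 ≤ G.orbitCoeff w K u)
    (fun u w u' => (u ≠ u' ∧ ¬ G.Adj u u') ∧
      ∀ K : Finset V, (K : Set V) ⊆ G.neighborSet w → G.IsClique (K : Set V) →
        ∑ u, G.orbitCoeff w K u * p.2 s(w, u) = 2 * p.1 w →
        2 ≤ G.orbitCoeff w K u + G.orbitCoeff w K u')
    (fun u w hu => exists_tight_local_extension hp hu) hab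
  · exfalso
    have hne : ∀ i j, i < j → v i ≠ v j := fun i j hij =>
      (hG.ne_and_adj_imp_of_locally_induced (n := j)
        (fun i _ => adj_of_mem_inducedPathCone hp (h i).1) (fun i _ => (h i).2.1) hij le_rfl).1
    refine not_injective_infinite_finite v fun i j hij => ?_
    by_contra hn
    rcases Nat.lt_or_gt_of_ne hn with hlt | hlt
    · exact hne _ _ hlt hij
    · exact hne _ _ hlt hij.symm
  · exact ⟨v, n, h0, h1, h2, h3, h4⟩

/-- The minimal face of a nonzero point of the induced path cone contains an induced path. -/
theorem Chordal.exists_isInducedPath_of_mem_inducedPathCone (hG : G.Chordal)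
    {p : (V → ℝ) × (Sym2 V → ℝ)} (hp : p ∈ G.inducedPathCone) (h0 : p ≠ 0) :
    ∃ W : Finset V, G.IsInducedPath W ∧ (∀ v ∈ W, 0 < p.1 v) ∧
      (∀ a ∈ W, ∀ b ∈ W, G.Adj a b → 0 < p.2 s(a, b)) ∧
      ∀ w ∈ W, ∀ K : Finset V, (K : Set V) ⊆ G.neighborSet w → G.IsClique (K : Set V) →
        ∑ u, G.orbitCoeff w K u * p.2 s(w, u) = 2 * p.1 w →
        2 ≤ ∑ u, G.orbitCoeff w K u * (G.xi W).2 s(w, u) := by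
  by_cases hy : ∀ e, p.2 e = 0
  · obtain ⟨v, hv⟩ : ∃ v, p.1 v ≠ 0 := by
      by_contra! hx
      exact h0 (Prod.ext (funext hx) (funext hy))
    have hv' : 0 < p.1 v := lt_of_le_of_ne (hp.1 v) hv.symm
    refine ⟨{v}, ?_, ?_, ?_, ?_⟩
    · simpa using hG.isInducedPath_image (n := 0) (v := fun _ => v) (by simp) (by simp)
    · simpa using hv'
    · simp
    · intro w hw K _ _ ht
      rw [mem_singleton.1 hw] at ht
      simp only [hy, mul_zero, sum_const_zero] at ht
      linarith
  push Not at hy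
  obtain ⟨e, he⟩ := hy
  induction e with
  | _ a b =>
  obtain ⟨v', n', -, -, h', -, hstart⟩ :=
    hG.exists_tight_walk hp (lt_of_le_of_ne (hp.2.1 _) he.symm)
  have hpos' := h' n' le_rfl
  rw [Sym2.eq_swap] at hpos'
  obtain ⟨v, n, hv0, hv1, hpos, hmid, hend⟩ := hG.exists_tight_walk hp hpos'
  rw [← hv0, ← hv1] at hstart
  have hadj : ∀ i < n + 1, G.Adj (v i) (v (i + 1)) := fun i hi =>
    adj_of_mem_inducedPathCone hp (hpos i (by omega))
  have hne : ∀ i, i + 2 ≤ n + 1 → v i ≠ v (i + 2) ∧ ¬ G.Adj (v i) (v (i + 2)) := fun i hi =>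
    (hmid i (by omega)).1
  have hmem : ∀ i ≤ n + 1, v i ∈ (range (n + 1 + 1)).image v := fun i hi =>
    mem_image_of_mem _ (by simpa using by omega)
  have hW := hG.isInducedPath_image hadj hne
  refine ⟨_, hW, ?_, ?_, ?_⟩
  · intro w hw
    obtain ⟨i, hi, rfl⟩ := mem_image.1 hw
    rw [mem_range] at hi
    by_cases hin : i ≤ n
    · exact fst_pos_of_mem_inducedPathCone hp (hpos i hin)
    · obtain rfl : i = n + 1 := by omega
      have := hpos n le_rfl
      rw [Sym2.eq_swap] at this
      exact fst_pos_of_mem_inducedPathCone hp this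
  · intro a ha b hb hab
    obtain ⟨i, hi, rfl⟩ := mem_image.1 ha
    obtain ⟨j, hj, rfl⟩ := mem_image.1 hb
    rw [mem_range] at hi hj
    rcases lt_trichotomy i j with h | rfl | h
    · obtain rfl := (hG.ne_and_adj_imp_of_locally_induced hadj hne h (by omega)).2 hab
      exact hpos i (by omega)
    · exact (G.loopless.irrefl _ hab).elim
    · obtain rfl := (hG.ne_and_adj_imp_of_locally_induced hadj hne h (by omega)).2 hab.symm
      rw [Sym2.eq_swap]
      exact hpos j (by omega)
  · intro w hw K hKw hK ht
    obtain ⟨i, hi, rfl⟩ := mem_image.1 hw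
    rw [mem_range] at hi
    set W := (range (n + 1 + 1)).image v
    have hterm : ∀ j ≤ n + 1, G.Adj (v i) (v j) →
        G.orbitCoeff (v i) K (v j) * (G.xi W).2 s(v i, v j) = G.orbitCoeff (v i) K (v j) := by
      intro j hj hA
      rw [xi_snd_mk, if_pos ⟨hA, hmem i (by omega), hmem j hj⟩, mul_one]
    have hnn : ∀ u, 0 ≤ G.orbitCoeff (v i) K u * (G.xi W).2 s(v i, u) := fun u =>
      mul_nonneg (orbitCoeff_nonneg _ _ _) (xi_snd_nonneg _ _)
    have hone : ∀ j ≤ n + 1, G.Adj (v i) (v j) →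
        G.orbitCoeff (v i) K (v j) ≤
          ∑ u, G.orbitCoeff (v i) K u * (G.xi W).2 s(v i, u) := by
      intro j hj hA
      rw [← hterm j hj hA]
      exact single_le_sum (f := fun u => G.orbitCoeff (v i) K u * (G.xi W).2 s(v i, u))
        (fun u _ => hnn u) (mem_univ _)
    by_cases hi0 : i = 0
    · subst hi0
      exact (hstart K hKw hK ht).trans (hone 1 (by omega) (hadj 0 (by omega)))
    by_cases hin : i = n + 1
    · subst hin
      exact (hend K hKw hK ht).trans (hone n (by omega) (hadj n (by omega)).symm)
    obtain ⟨k, rfl⟩ := Nat.exists_eq_succ_of_ne_zero hi0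
    refine ((hmid k (by omega)).2 K hKw hK ht).trans ?_
    rw [← hterm k (by omega) (hadj k (by omega)).symm,
      ← hterm (k + 2) (by omega) (hadj (k + 1) (by omega)),
      ← sum_pair (f := fun u => G.orbitCoeff (v (k + 1)) K u * (G.xi W).2 s(v (k + 1), u))
        (hmid k (by omega)).1.1]
    exact sum_le_sum_of_subset_of_nonneg (subset_univ _) fun u _ _ => hnn u

/-- The left sides of the inequalities `0 ≤ l p` describing the induced path cone. -/
noncomputable def pathConeForm (G : SimpleGraph V) :
    V ⊕ Sym2 V ⊕ Sym2 V ⊕ V × Finset V → (V → ℝ) × (Sym2 V → ℝ) → ℝ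
  | .inl v, p => p.1 v
  | .inr (.inl e), p => p.2 e
  | .inr (.inr (.inl e)), p => if e ∈ G.edgeSet then 0 else -p.2 e
  | .inr (.inr (.inr (w, K))), p =>
    if (K : Set V) ⊆ G.neighborSet w ∧ G.IsClique (K : Set V) then
      2 * p.1 w - ∑ u, G.orbitCoeff w K u * p.2 s(w, u) else 0

theorem pathConeForm_sub_smul (i : V ⊕ Sym2 V ⊕ Sym2 V ⊕ V × Finset V)
    (p s : (V → ℝ) × (Sym2 V → ℝ)) (ε : ℝ) :
    G.pathConeForm i (p - ε • s) = G.pathConeForm i p - ε * G.pathConeForm i s := by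
  rcases i with v | e | e | ⟨w, K⟩
  · simp [pathConeForm]
  · simp [pathConeForm]
  · simp only [pathConeForm]
    split_ifs
    · simp
    · simp; ring
  · simp only [pathConeForm]
    split_ifs
    · have : ∑ u, G.orbitCoeff w K u * (p - ε • s).2 s(w, u) =
          ∑ u, G.orbitCoeff w K u * p.2 s(w, u) -
            ε * ∑ u, G.orbitCoeff w K u * s.2 s(w, u) := by
        rw [mul_sum, ← sum_sub_distrib]
        exact sum_congr rfl fun u _ => by simp; ring
      rw [this]
      simp
      ring
    · simp

theorem forall_pathConeForm_nonneg_iff {p : (V → ℝ) × (Sym2 V → ℝ)} :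
    (∀ i, 0 ≤ G.pathConeForm i p) ↔ p ∈ G.inducedPathCone := by
  rw [mem_inducedPathCone_iff]
  simp only [Sum.forall, Prod.forall, pathConeForm]
  refine and_congr_right fun _ => and_congr_right fun hy => and_congr ?_ ?_
  · refine forall_congr' fun e => ?_
    split_ifs with he
    · simp [he]
    · simp only [he, not_false_eq_true, true_imp_iff]
      exact ⟨fun h => le_antisymm (by linarith) (hy e), fun h => by rw [h]; simp⟩
  · refine forall₂_congr fun w K => ?_
    split_ifs with h
    · simp [h.1, h.2]
    · simp only [le_refl, true_iff]
      exact fun h1 h2 => (h ⟨h1, h2⟩).elim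

theorem IsInducedPath.xi_mem_inducedPathCone {W : Finset V} (hW : G.IsInducedPath W) :
    G.xi W ∈ G.inducedPathCone :=
  mem_inducedPathCone_iff.2 ⟨xi_fst_nonneg W, xi_snd_nonneg W, fun _ => xi_snd_eq_zero W,
    fun w _ _ hK => hW.sum_orbitCoeff_le w hK⟩

theorem convex_pathPolyP : Convex ℝ G.pathPolyP := by
  intro p hp q hq a b ha hb hab
  have hcomb : a • p + b • q = a • p - (-b) • q := by rw [neg_smul, sub_neg_eq_add]
  refine ⟨forall_pathConeForm_nonneg_iff.1 fun i => ?_, ?_⟩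
  · have h1 := forall_pathConeForm_nonneg_iff.2 hp.1 i
    have h2 := forall_pathConeForm_nonneg_iff.2 hq.1 i
    have h3 : G.pathConeForm i (a • p) = a * G.pathConeForm i p := by
      have h4 := pathConeForm_sub_smul (G := G) i (a • p) p a
      have h5 := pathConeForm_sub_smul (G := G) i p p 1
      rw [one_smul, sub_self] at h5
      rw [sub_self] at h4
      linarith
    rw [hcomb, pathConeForm_sub_smul, h3]
    have := mul_nonneg ha h1
    have := mul_nonneg hb h2
    linarith
  · have h1 := hp.2
    have h2 := hq.2
    simp only [Prod.fst_add, Prod.snd_add, Prod.smul_fst, Prod.smul_snd, Pi.add_apply,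
      Pi.smul_apply, smul_eq_mul, sum_add_distrib, ← mul_sum]
    linear_combination a * h1 + b * h2 + hab

theorem inducedPathPolytope_subset_pathPolyP : G.inducedPathPolytope ⊆ G.pathPolyP := by
  refine convexHull_min ?_ convex_pathPolyP
  rintro p ⟨W, hW, rfl⟩
  exact ⟨hW.xi_mem_inducedPathCone, hW.sum_xi⟩

/-- For chordal graphs, the induced path polytope is the intersection of the induced path cone
with the hyperplane. -/
theorem Chordal.inducedPathPolytope_eq_pathPolyP (hG : G.Chordal) :
    G.inducedPathPolytope = G.pathPolyP := by
  refine inducedPathPolytope_subset_pathPolyP.antisymm ?_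
  rintro p ⟨hp, hsum⟩
  have hdec := exists_smul_convexHull_of_exists_face_generator G.pathConeForm
    {p | ∃ W : Finset V, G.IsInducedPath W ∧ p = G.xi W} pathConeForm_sub_smul ?_ ?_ p
    (forall_pathConeForm_nonneg_iff.2 hp)
  · rcases hdec with rfl | ⟨t, ht, q, hq, rfl⟩
    · simp at hsum
    · have hq1 := (inducedPathPolytope_subset_pathPolyP (G := G) hq).2
      simp only [Prod.smul_fst, Prod.smul_snd, Pi.smul_apply, smul_eq_mul, ← mul_sum] at hsum
      rw [← mul_sub, hq1, mul_one] at hsum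
      rw [hsum, one_smul]
      exact hq
  · rintro s ⟨W, hW, rfl⟩
    exact forall_pathConeForm_nonneg_iff.2 hW.xi_mem_inducedPathCone
  · intro p hp h0
    rw [forall_pathConeForm_nonneg_iff] at hp
    obtain ⟨W, hW, hx, hy, ht⟩ := hG.exists_isInducedPath_of_mem_inducedPathCone hp h0
    refine ⟨_, ⟨W, hW, rfl⟩, ?_, ?_⟩
    · rintro (v | e | e | ⟨w, K⟩) h
      · simp only [pathConeForm] at h ⊢
        have : v ∉ W := fun hv => (hx v hv).ne' h
        simp [xi, this]
      · simp only [pathConeForm] at h ⊢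
        induction e with
        | _ a b =>
        rw [xi_snd_mk, if_neg]
        exact fun hab => (hy a hab.2.1 b hab.2.2 hab.1).ne' h
      · simp only [pathConeForm]
        split_ifs with he
        · rfl
        · rw [xi_snd_eq_zero W he, neg_zero]
      · simp only [pathConeForm] at h ⊢
        split_ifs at h ⊢ with hK
        · have hle := hW.sum_orbitCoeff_le w hK.2
          by_cases hw : w ∈ W
          · have hge := ht w hw K hK.1 hK.2 (by linarith)
            have : (G.xi W).1 w = 1 := by simp [xi, hw]
            rw [this] at hle ⊢
            linarith
          · simp [hw, xi]
        · rfl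
    · obtain ⟨n, v, -, hmem, -⟩ := hW.exists_enum
      refine ⟨.inl (v 0), ?_⟩
      have : v 0 ∈ W := (hmem _).2 ⟨0, rfl⟩
      simp [pathConeForm, xi, this]

end SimpleGraph

/-- for chordal `G`, the induced path polytope is described by the
hyperplane, nonnegativity, and the inequalities associated with orbit-defining cliques. -/
theorem inducedPathPolytope_orbit_description {V : Type*} [Fintype V] (G : SimpleGraph V)
    (hG : G.Chordal) :
    G.inducedPathPolytope =
      {p : (V → ℝ) × (Sym2 V → ℝ) |
        (∑ v : V, p.1 v - ∑ e : Sym2 V, p.2 e = 1) ∧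
        (∀ v, 0 ≤ p.1 v) ∧ (∀ e, 0 ≤ p.2 e) ∧ (∀ e, e ∉ G.edgeSet → p.2 e = 0) ∧
        ∀ (w : V) (K : Finset V), G.DefinesOrbit w K →
          ∑ u ∈ G.completeTo (insert w K), p.2 s(w, u) +
            2 * ∑ u ∈ K, p.2 s(w, u) ≤ 2 * p.1 w} := by
  rw [hG.inducedPathPolytope_eq_pathPolyP]
  ext p
  simp only [pathPolyP, Set.mem_ofPred_eq, mem_inducedPathCone_iff, sum_completeTo_add_eq]
  constructor
  · rintro ⟨⟨hx, hy, hE, h⟩, hsum⟩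
    exact ⟨hsum, hx, hy, hE, fun w K hK => h w K hK.1 hK.2.1⟩
  · rintro ⟨hsum, hx, hy, hE, h⟩
    exact ⟨⟨hx, hy, hE, fun w => sum_orbitCoeff_le_of_definesOrbit (fun u => hy _) (h w)⟩, hsum⟩
end

section
/- In the setup below, for every u ∈ N(v): either y'_{uv} = y*_{uv}, or the support of λ contains no induced path having u as an extremity whose intersection with the closed neighborhood N[v] equals {u}. -/
open SimpleGraph Finset
open scoped Classical

namespace SimpleGraph

variable {V : Type*} {G : SimpleGraph V}

/-- A finite vertex set induces a path iff its vertices can be listed so that adjacency is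
consecutiveness. -/
theorem isInducedPath_iff_exists_enum {W : Finset V} :
    G.IsInducedPath W ↔ ∃ n : ℕ, 1 ≤ n ∧ ∃ f : Fin n → V, Function.Injective f ∧
      (∀ w, w ∈ W ↔ ∃ i, f i = w) ∧
      ∀ i j, G.Adj (f i) (f j) ↔ i.val + 1 = j.val ∨ j.val + 1 = i.val := by
  constructor
  · rintro ⟨n, hn, ⟨φ⟩⟩
    refine ⟨n, hn, fun i => (φ.symm i : V), fun i j h => φ.symm.injective (Subtype.ext h),
      fun w => ⟨fun hw => ⟨φ ⟨w, hw⟩, by simp⟩, ?_⟩, fun i j => ?_⟩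
    · rintro ⟨i, rfl⟩
      exact (φ.symm i).2
    · rw [← pathGraph_adj, ← φ.symm.map_adj_iff]
      rfl
  · rintro ⟨n, hn, f, hf, hW, hadj⟩
    let e : Fin n ≃ (W : Set V) := Equiv.ofBijective (fun i => ⟨f i, (hW _).2 ⟨i, rfl⟩⟩)
      ⟨fun i j h => hf (congrArg Subtype.val h), fun w => by
        obtain ⟨i, hi⟩ := (hW w).1 w.2
        exact ⟨i, Subtype.ext hi⟩⟩
    have h : ∀ {i j : Fin n}, (G.induce (W : Set V)).Adj (e i) (e j) ↔ (pathGraph n).Adj i j := by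
      intro i j
      rw [pathGraph_adj, ← hadj]
      rfl
    exact ⟨n, hn, ⟨(RelIso.mk e h).symm⟩⟩

/-- The vertices of an induced path can be listed starting from any given extremity. -/
theorem IsInducedPath.exists_enum_of_isExtremity {W : Finset V} {u : V} (hW : G.IsInducedPath W)
    (hu : G.IsExtremity u W) :
    ∃ n : ℕ, ∃ f : Fin (n + 1) → V, f 0 = u ∧ Function.Injective f ∧
      (∀ w, w ∈ W ↔ ∃ i, f i = w) ∧
      ∀ i j, G.Adj (f i) (f j) ↔ i.val + 1 = j.val ∨ j.val + 1 = i.val := by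
  obtain ⟨n, hn, f, hf, hmem, hadj⟩ := isInducedPath_iff_exists_enum.1 hW
  obtain ⟨n, rfl⟩ := Nat.exists_eq_add_of_le' hn
  obtain ⟨k, rfl⟩ := (hmem u).1 hu.1
  have hk : k.val = 0 ∨ k.val = n := by
    by_contra! h
    have hkn := k.2
    let a : Fin (n + 1) := ⟨k.val - 1, by omega⟩
    let b : Fin (n + 1) := ⟨k.val + 1, by omega⟩
    have ha : f a ∈ W.filter fun w => G.Adj (f k) w := by
      rw [Finset.mem_filter, hmem, hadj]
      exact ⟨⟨a, rfl⟩, Or.inr (by simp only [a]; omega)⟩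
    have hb : f b ∈ W.filter fun w => G.Adj (f k) w := by
      rw [Finset.mem_filter, hmem, hadj]
      exact ⟨⟨b, rfl⟩, Or.inl rfl⟩
    have hab := congrArg Fin.val (hf (Finset.card_le_one.1 hu.2 _ ha _ hb))
    simp only [a, b] at hab
    omega
  rcases hk with hk | hk
  · exact ⟨n, f, congrArg f (Fin.ext hk.symm), hf, hmem, hadj⟩
  · refine ⟨n, f ∘ Fin.rev, congrArg f (Fin.ext (by simp [hk])), hf.comp Fin.rev_injective,
      fun w => ?_, fun i j => ?_⟩
    · rw [hmem]
      exact Fin.rev_surjective.exists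
    · have hi := i.2
      have hj := j.2
      simp only [Function.comp, hadj, Fin.val_rev]
      omega

/-- An induced path can be extended by a vertex whose only neighbor on it is an extremity. -/
theorem IsInducedPath.insert_of_isExtremity {W : Finset V} {u v : V} (hW : G.IsInducedPath W)
    (hu : G.IsExtremity u W) (hv : v ∉ W) (hadj : ∀ w ∈ W, G.Adj v w ↔ w = u) :
    G.IsInducedPath (insert v W) := by
  obtain ⟨n, f, rfl, hf, hmem, hf_adj⟩ := hW.exists_enum_of_isExtremity hu
  have hvf : ∀ i : Fin (n + 1), G.Adj v (f i) ↔ i.val = 0 := fun i => by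
    rw [hadj _ ((hmem _).2 ⟨i, rfl⟩), hf.eq_iff, Fin.ext_iff]
    rfl
  refine isInducedPath_iff_exists_enum.2 ⟨n + 1 + 1, by omega, Fin.cons v f,
    Fin.cons_injective_iff.2 ⟨?_, hf⟩, fun w => ?_, fun i j => ?_⟩
  · rintro ⟨i, hi⟩
    exact hv ((hmem v).2 ⟨i, hi⟩)
  · rw [Finset.mem_insert, hmem, Fin.exists_fin_succ (n := n + 1)]
    simp only [Fin.cons_zero, Fin.cons_succ, eq_comm (a := w)]
  · refine Fin.cases ?_ (fun i => ?_) i <;> refine Fin.cases ?_ (fun j => ?_) j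
    · simp
    · simp only [Fin.cons_zero, Fin.cons_succ, hvf, Fin.val_zero, Fin.val_succ]
      omega
    · simp only [Fin.cons_zero, Fin.cons_succ, G.adj_comm _ v, hvf, Fin.val_zero, Fin.val_succ]
      omega
    · simp only [Fin.cons_succ, hf_adj, Fin.val_succ]
      omega

/-- A vertex of an induced path with at least two vertices has a neighbor on that path. -/
theorem IsInducedPath.eq_singleton_or_exists_adj {W : Finset V} {v : V} (hW : G.IsInducedPath W)
    (hv : v ∈ W) : W = {v} ∨ ∃ w ∈ W, G.Adj w v := by
  obtain ⟨n, hn, f, hf, hmem, hadj⟩ := isInducedPath_iff_exists_enum.1 hW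
  obtain ⟨k, rfl⟩ := (hmem v).1 hv
  have hkn := k.2
  by_cases hk : k.val = 0
  · by_cases h1 : n = 1
    · subst h1
      left
      ext w
      rw [hmem, Finset.mem_singleton]
      exact ⟨fun ⟨i, hi⟩ => by rw [← hi, Subsingleton.elim i k], fun h => ⟨k, h.symm⟩⟩
    · exact Or.inr ⟨f ⟨1, by omega⟩, (hmem _).2 ⟨_, rfl⟩, (hadj _ _).2 (Or.inr (by simp [hk]))⟩
  · exact Or.inr ⟨f ⟨k.val - 1, by omega⟩, (hmem _).2 ⟨_, rfl⟩,
      (hadj _ _).2 (Or.inl (by simp only; omega))⟩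

theorem xi_fst_apply (W : Finset V) (w : V) : (G.xi W).1 w = if w ∈ W then 1 else 0 := rfl

/-- Adding to `W` a vertex with a single neighbor in `W` adds that vertex and one edge to the
extended incidence vector. -/
theorem xi_insert {W : Finset V} {u v : V} (hu : u ∈ W) (hv : v ∉ W)
    (hadj : ∀ w ∈ W, G.Adj v w ↔ w = u) :
    G.xi (insert v W) = G.xi W + (Pi.single v 1, Pi.single s(u, v) 1) := by
  refine Prod.ext (funext fun w => ?_) (funext fun e => ?_)
  · by_cases hw : w = v
    · subst hw
      simp [xi_fst_apply, hv]
    · simp [xi_fst_apply, hw]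
  · induction e using Sym2.ind with
    | _ a b =>
      have hvu : G.Adj v u := (hadj u hu).2 rfl
      have ha := hadj a
      have hb := hadj b
      simp only [Prod.snd_add, Pi.add_apply, xi_snd_mk, Pi.single_apply, Sym2.eq_iff,
        Finset.mem_insert]
      by_cases hav : a = v <;> by_cases hbv : b = v
      · subst hav hbv
        simp [hv, hvu.ne]
      · subst hav
        by_cases hbW : b ∈ W
        · simp [hv, hbv, hbW, hb hbW, hvu.ne]
        · have : b ≠ u := fun h => hbW (h ▸ hu)
          simp [hv, hbv, hbW, this]
      · subst hbv
        by_cases haW : a ∈ W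
        · simp [hv, hav, haW, ha haW, hvu.ne, G.adj_comm a b]
        · have : a ≠ u := fun h => haW (h ▸ hu)
          simp [hv, hav, haW, this]
      · simp [hav, hbv]

theorem xi_singleton (v : V) : G.xi {v} = (Pi.single v 1, 0) := by
  refine Prod.ext (funext fun w => ?_) (funext fun e => ?_)
  · simp [xi_fst_apply, Pi.single_apply]
  · induction e using Sym2.ind with
    | _ a b =>
      rw [xi_snd_mk, if_neg]
      · rfl
      · rintro ⟨h, ha, hb⟩
        rw [Finset.mem_singleton] at ha hb
        exact h.ne (ha.trans hb.symm)

variable [Fintype V]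

theorem mem_nbrF {v u : V} : u ∈ G.nbrF v ↔ G.Adj v u := by simp [nbrF]

theorem fst_sum_smul_xi (c : Finset V → ℝ) (w : V) :
    (∑ W, c W • G.xi W).1 w = ∑ W, c W * (G.xi W).1 w := by
  simp [Prod.fst_sum]

theorem snd_sum_smul_xi (c : Finset V → ℝ) (e : Sym2 V) :
    (∑ W, c W • G.xi W).2 e = ∑ W, c W * (G.xi W).2 e := by
  simp [Prod.snd_sum]

/-- In a combination of induced paths, the weight at `v` is at most the multiplicity of the path
`{v}` plus the total weight of the edges at `v`. -/
theorem fst_sum_smul_xi_le {lam : Finset V → ℕ} (hlam : ∀ W, lam W ≠ 0 → G.IsInducedPath W)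
    (v : V) :
    (∑ W, (lam W : ℝ) • G.xi W).1 v ≤
      lam {v} + ∑ u ∈ G.nbrF v, (∑ W, (lam W : ℝ) • G.xi W).2 s(u, v) := by
  simp only [fst_sum_smul_xi, snd_sum_smul_xi]
  rw [Finset.sum_comm]
  simp only [← Finset.mul_sum]
  have hsingle : (lam {v} : ℝ) = ∑ W : Finset V, (lam W : ℝ) * if W = {v} then 1 else 0 := by
    simp
  rw [hsingle, ← Finset.sum_add_distrib]
  refine Finset.sum_le_sum fun W _ => ?_
  rw [← mul_add]
  rcases eq_or_ne (lam W) 0 with h0 | h0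
  · simp [h0]
  refine mul_le_mul_of_nonneg_left ?_ (Nat.cast_nonneg _)
  have hnn : ∀ u ∈ G.nbrF v, 0 ≤ (G.xi W).2 s(u, v) := fun u _ => by
    rw [xi_snd_mk]
    positivity
  have hnn' := Finset.sum_nonneg hnn
  rw [xi_fst_apply]
  by_cases hv : v ∈ W
  · rcases (hlam W h0).eq_singleton_or_exists_adj hv with h | ⟨w, hw, hwv⟩
    · rw [if_pos hv, if_pos h]
      linarith
    · have h1 := Finset.single_le_sum hnn (mem_nbrF.2 hwv.symm)
      rw [xi_snd_mk, if_pos ⟨hwv, hw, hv⟩] at h1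
      rw [if_pos hv]
      split_ifs <;> linarith
  · rw [if_neg hv]
    split_ifs <;> linarith

/-- At a simplicial vertex, the induced path cone bounds the total edge weight by the vertex
weight. -/
theorem sum_nbrF_le_of_mem_inducedPathCone {p : (V → ℝ) × (Sym2 V → ℝ)}
    (hp : p ∈ G.inducedPathCone) {v : V} (hv : G.IsClique (G.neighborSet v)) :
    ∑ u ∈ G.nbrF v, p.2 s(u, v) ≤ p.1 v := by
  have hcoe : (G.nbrF v : Set V) = G.neighborSet v := by
    ext u
    simp [mem_nbrF]
  have h := hp.2.2.2 v (G.nbrF v) hcoe.le (hcoe ▸ hv)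
  have hnn : 0 ≤ ∑ u ∈ G.completeTo (insert v (G.nbrF v)), p.2 s(v, u) :=
    Finset.sum_nonneg fun u _ => hp.2.1 _
  simp only [Sym2.eq_swap (a := v)] at h hnn
  linarith

/-- Replacing a path `A` of a combination by a path `B`, and deleting `k` copies of a path `C`. -/
theorem exists_sum_smul_xi_exchange {lam : Finset V → ℕ}
    (hlam : ∀ W, lam W ≠ 0 → G.IsInducedPath W) {A B C : Finset V} {k : ℕ} (hA : lam A ≠ 0)
    (hB : G.IsInducedPath B) (hAC : A ≠ C) (hC : k ≤ lam C) :
    ∃ mu : Finset V → ℕ, (∀ W, mu W ≠ 0 → G.IsInducedPath W) ∧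
      ∑ W, (mu W : ℝ) • G.xi W =
        ∑ W, (lam W : ℝ) • G.xi W - G.xi A + G.xi B - (k : ℝ) • G.xi C := by
  let mu : Finset V → ℕ := fun W =>
    lam W - (if W = A then 1 else 0) - (if W = C then k else 0) + if W = B then 1 else 0
  have hmu : ∀ W, (mu W : ℝ) = lam W - (if W = A then 1 else 0) + (if W = B then 1 else 0) -
      if W = C then (k : ℝ) else 0 := by
    intro W
    have h : mu W + (if W = A then 1 else 0) + (if W = C then k else 0) =
        lam W + if W = B then 1 else 0 := by
      simp only [mu]
      rcases eq_or_ne W A with rfl | h1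
      · simp only [if_true, if_neg hAC]
        omega
      · rcases eq_or_ne W C with rfl | h2
        · simp only [if_true, if_neg h1]
          omega
        · simp [h1, h2]
    have h' := congrArg (Nat.cast (R := ℝ)) h
    push_cast at h'
    linarith
  refine ⟨mu, fun W hW => ?_, ?_⟩
  · by_cases h : W = B
    · exact h ▸ hB
    · refine hlam W fun h0 => hW ?_
      simp [mu, h, h0]
  · simp only [hmu, sub_smul, add_smul, Finset.sum_sub_distrib, Finset.sum_add_distrib, ite_smul,
      one_smul, zero_smul, Finset.sum_ite_eq', Finset.mem_univ, if_true]

end SimpleGraph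

theorem add_one_le_of_lt_of_int {a b : ℝ} (ha : ∃ m : ℤ, a = m) (hb : ∃ n : ℤ, b = n)
    (h : a < b) : a + 1 ≤ b := by
  obtain ⟨m, rfl⟩ := ha
  obtain ⟨n, rfl⟩ := hb
  exact_mod_cast h

/-- for every `u ∈ N(v)`, either `y'_{uv} = y*_{uv}` or no path in the
support of `λ` has `u` as an extremity with intersection with `N[v]` equal to `{u}`. -/
theorem lem_psiu_empty
    {V : Type*} [Fintype V] (G : SimpleGraph V) (hG : G.Chordal)
    (v : V) (hsimp : G.IsClique (G.neighborSet v))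
    (ps : (V → ℝ) × (Sym2 V → ℝ)) (hps : ps ∈ G.inducedPathCone)
    (hintx : ∀ w, ∃ n : ℤ, ps.1 w = n) (hinty : ∀ e, ∃ n : ℤ, ps.2 e = n)
    (lam : Finset V → ℕ) (hlam : ∀ W, lam W ≠ 0 → G.IsInducedPath W)
    (p' : (V → ℝ) × (Sym2 V → ℝ)) (hp' : p' = ∑ W : Finset V, (lam W : ℝ) • G.xi W)
    (hle1 : ∀ w, p'.1 w ≤ ps.1 w) (hle2 : ∀ e, p'.2 e ≤ ps.2 e)
    (heq1 : ∀ w, w ≠ v → p'.1 w = ps.1 w)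
    (heq2 : ∀ e : Sym2 V, v ∉ e → p'.2 e = ps.2 e)
    (hmin : ∀ (mu : Finset V → ℕ) (q : (V → ℝ) × (Sym2 V → ℝ)),
      q = ∑ W : Finset V, (mu W : ℝ) • G.xi W →
      (∀ W, mu W ≠ 0 → G.IsInducedPath W) →
      (∀ w, q.1 w ≤ ps.1 w) → (∀ e, q.2 e ≤ ps.2 e) →
      (∀ w, w ≠ v → q.1 w = ps.1 w) →
      (∀ e : Sym2 V, v ∉ e → q.2 e = ps.2 e) →
      ∑ u ∈ G.nbrF v, (ps.2 s(u, v) - p'.2 s(u, v)) ≤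
        ∑ u ∈ G.nbrF v, (ps.2 s(u, v) - q.2 s(u, v))) :
    ∀ u ∈ G.nbrF v,
      p'.2 s(u, v) = ps.2 s(u, v) ∨
      ¬ ∃ W : Finset V, lam W ≠ 0 ∧ G.IsExtremity u W ∧
          W ∩ insert v (G.nbrF v) = {u} := by
  intro u hu
  by_contra hcon
  push Not at hcon
  obtain ⟨hne, W, hW, hext, hcap⟩ := hcon
  have hvu : G.Adj v u := mem_nbrF.1 hu
  have hvW : v ∉ W := fun h => by
    have : v ∈ W ∩ insert v (G.nbrF v) := by simp [h]
    rw [hcap, Finset.mem_singleton] at this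
    exact hvu.ne this
  have hadj : ∀ w ∈ W, G.Adj v w ↔ w = u := fun w hw => by
    refine ⟨fun h => ?_, fun h => h ▸ hvu⟩
    have : w ∈ W ∩ insert v (G.nbrF v) := by simp [hw, mem_nbrF, h]
    rwa [hcap, Finset.mem_singleton] at this
  have hpath := (hlam W hW).insert_of_isExtremity hext hvW hadj
  have hylt := lt_of_le_of_ne (hle2 s(u, v)) hne
  have hyint : ∃ n : ℤ, p'.2 s(u, v) = n :=
    ⟨∑ P, (lam P : ℤ) * if G.Adj u v ∧ u ∈ P ∧ v ∈ P then 1 else 0, by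
      rw [hp', snd_sum_smul_xi]
      push_cast
      simp only [xi_snd_mk]⟩
  have hxint : ∃ n : ℤ, p'.1 v = n :=
    ⟨∑ P, (lam P : ℤ) * if v ∈ P then 1 else 0, by
      rw [hp', fst_sum_smul_xi]
      push_cast
      simp only [xi_fst_apply]⟩
  have hy1 := add_one_le_of_lt_of_int hyint (hinty _) hylt
  obtain ⟨k, hk, hx1⟩ : ∃ k : ℕ, k ≤ lam {v} ∧ p'.1 v + 1 - k ≤ ps.1 v := by
    rcases (hle1 v).lt_or_eq with hlt | heq
    · exact ⟨0, Nat.zero_le _, by simpa using add_one_le_of_lt_of_int hxint (hintx v) hlt⟩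
    · refine ⟨1, ?_, by simp [heq]⟩
      have h1 := fst_sum_smul_xi_le hlam v
      rw [← hp'] at h1
      have h2 := sum_nbrF_le_of_mem_inducedPathCone hps hsimp
      have h3 : ∑ w ∈ G.nbrF v, p'.2 s(w, v) < ∑ w ∈ G.nbrF v, ps.2 s(w, v) :=
        Finset.sum_lt_sum (fun w _ => hle2 _) ⟨u, hu, hylt⟩
      have h4 : (0 : ℝ) < lam {v} := by linarith
      exact_mod_cast h4
  obtain ⟨mu, hmu, hsum⟩ := exists_sum_smul_xi_exchange hlam (C := {v}) hW hpath
    (fun h => hvW (h ▸ Finset.mem_singleton_self v)) hk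
  rw [← hp', xi_insert hext.1 hvW hadj, xi_singleton] at hsum
  set q := ∑ P, (mu P : ℝ) • G.xi P with hq
  have hq1 : ∀ w, q.1 w = p'.1 w + if w = v then 1 - (k : ℝ) else 0 := fun w => by
    rw [hsum]
    by_cases hw : w = v
    · subst hw
      simp
      ring
    · simp [hw]
  have hq2 : ∀ e, q.2 e = p'.2 e + if e = s(u, v) then 1 else 0 := fun e => by
    rw [hsum]
    simp [Pi.single_apply]
    ring
  have hΔ := hmin mu q hq hmu
    (fun w => by
      rw [hq1]
      split_ifs with h
      · subst h
        linarith
      · simpa using hle1 w)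
    (fun e => by
      rw [hq2]
      split_ifs with h
      · subst h
        exact hy1
      · simpa using hle2 e)
    (fun w hw => by rw [hq1, if_neg hw, add_zero, heq1 w hw])
    (fun e he => by
      have : e ≠ s(u, v) := fun h => he (h ▸ Sym2.mem_mk_right u v)
      rw [hq2, if_neg this, add_zero, heq2 e he])
  refine hΔ.not_gt (Finset.sum_lt_sum (fun w _ => ?_) ⟨u, hu, ?_⟩)
  · rw [hq2]
    split_ifs <;> linarith
  · rw [hq2, if_pos rfl]
    linarith
end

section
/- In the setup below, for every u ∈ N(v): either y'_{uv} = y*_{uv}, or λ assigns coefficient 0 to the two-vertex induced path {u,v}. -/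
open SimpleGraph Finset
open scoped Classical

/-- An induced path is the image of an injective enumeration whose adjacent terms are exactly the
consecutive ones. -/
theorem SimpleGraph.isInducedPath_iff_exists_enum_s10 {V : Type*} (G : SimpleGraph V) (W : Finset V) :
    G.IsInducedPath W ↔ ∃ (n : ℕ) (f : ℕ → V), 1 ≤ n ∧ (∀ w, w ∈ W ↔ ∃ i < n, f i = w) ∧
      (∀ i < n, ∀ j < n, f i = f j → i = j) ∧
      ∀ i < n, ∀ j < n, (G.Adj (f i) (f j) ↔ i + 1 = j ∨ j + 1 = i) := by
  constructor
  · rintro ⟨n, hn, ⟨φ⟩⟩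
    refine ⟨n, fun i => if h : i < n then (φ.symm ⟨i, h⟩ : V) else (φ.symm ⟨0, hn⟩ : V), hn,
      ?_, ?_, ?_⟩
    · intro w
      constructor
      · intro hw
        refine ⟨(φ ⟨w, hw⟩).1, (φ ⟨w, hw⟩).2, ?_⟩
        simp
      · rintro ⟨i, hi, rfl⟩
        simp only [hi, dif_pos]
        exact (φ.symm ⟨i, hi⟩).2
    · intro i hi j hj h
      simp only [hi, hj, dif_pos] at h
      have := φ.symm.injective (Subtype.ext h)
      simpa using this
    · intro i hi j hj
      simp only [hi, hj, dif_pos]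
      have := φ.symm.map_adj_iff (v := ⟨i, hi⟩) (w := ⟨j, hj⟩)
      rw [SimpleGraph.pathGraph_adj] at this
      simpa using this
  · rintro ⟨n, f, hn, hW, hinj, hadj⟩
    have hmem : ∀ i : Fin n, f i ∈ (W : Set V) := fun i => (hW _).2 ⟨i, i.2, rfl⟩
    let g : Fin n → (W : Set V) := fun i => ⟨f i, hmem i⟩
    have hg : Function.Bijective g := by
      constructor
      · intro i j h
        exact Fin.ext (hinj i i.2 j j.2 (congrArg Subtype.val h))
      · rintro ⟨w, hw⟩
        obtain ⟨i, hi, rfl⟩ := (hW w).1 hw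
        exact ⟨⟨i, hi⟩, rfl⟩
    let e : SimpleGraph.pathGraph n ≃g G.induce (W : Set V) :=
      { toEquiv := Equiv.ofBijective g hg
        map_rel_iff' := by
          intro i j
          rw [SimpleGraph.pathGraph_adj]
          exact hadj i i.2 j j.2 }
    exact ⟨n, hn, ⟨e.symm⟩⟩

/-- A vertex of an induced path with at least two vertices has a neighbor in it. -/
theorem SimpleGraph.IsInducedPath.exists_adj {V : Type*} {G : SimpleGraph V} {W : Finset V}
    (hW : G.IsInducedPath W) {v : V} (hv : v ∈ W) (hne : W ≠ {v}) : ∃ w ∈ W, G.Adj v w := by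
  obtain ⟨n, f, -, hmem, -, hadj⟩ := (G.isInducedPath_iff_exists_enum_s10 W).1 hW
  obtain ⟨i, hi, rfl⟩ := (hmem v).1 hv
  rcases lt_or_ge (i + 1) n with h | h
  · exact ⟨f (i + 1), (hmem _).2 ⟨_, h, rfl⟩, (hadj _ hi _ h).2 (Or.inl rfl)⟩
  · rcases Nat.eq_zero_or_pos i with rfl | hpos
    · refine absurd ?_ hne
      ext w
      rw [hmem, Finset.mem_singleton]
      constructor
      · rintro ⟨j, hj, rfl⟩
        congr 1
        omega
      · rintro rfl
        exact ⟨0, hi, rfl⟩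
    · exact ⟨f (i - 1), (hmem _).2 ⟨_, by omega, rfl⟩,
        (hadj _ hi _ (by omega)).2 (Or.inr (by omega))⟩

/-- If `v ∉ P` has `u` as its only neighbor in the induced path `P`, then `P` splits at `u` into
two parts, each of which is extended by `v` to an induced path. -/
theorem SimpleGraph.IsInducedPath.exists_split {V : Type*} {G : SimpleGraph V} {P : Finset V}
    (hP : G.IsInducedPath P) {u v : V} (hu : u ∈ P) (hv : v ∉ P)
    (hadj : ∀ w ∈ P, G.Adj v w ↔ w = u) :
    ∃ A B : Finset V, (∀ w, w ∈ P ↔ w ∈ A ∨ w ∈ B) ∧ (∀ w, w ∈ A ∧ w ∈ B ↔ w = u) ∧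
      (∀ a ∈ A, ∀ b ∈ B, G.Adj a b → a = u ∨ b = u) ∧
      G.IsInducedPath (insert v A) ∧ G.IsInducedPath (insert v B) := by
  obtain ⟨n, f, -, hmem, hinj, hf⟩ := (G.isInducedPath_iff_exists_enum_s10 P).1 hP
  obtain ⟨i, hi, rfl⟩ := (hmem u).1 hu
  have hfP : ∀ j < n, f j ∈ P := fun j hj => (hmem _).2 ⟨j, hj, rfl⟩
  have hvf : ∀ j < n, f j ≠ v := fun j hj h => hv (h ▸ hfP j hj)
  have hvadj : ∀ j < n, (G.Adj v (f j) ↔ j = i) := fun j hj =>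
    (hadj _ (hfP j hj)).trans ⟨fun h => hinj _ hj _ hi h, fun h => h ▸ rfl⟩
  refine ⟨(Finset.range (i + 1)).image f, (Finset.Ico i n).image f, ?_, ?_, ?_, ?_, ?_⟩
  · intro w
    simp only [Finset.mem_image, Finset.mem_range, Finset.mem_Ico, hmem]
    constructor
    · rintro ⟨j, hj, rfl⟩
      rcases le_total j i with h | h
      · exact Or.inl ⟨j, by omega, rfl⟩
      · exact Or.inr ⟨j, ⟨h, hj⟩, rfl⟩
    · rintro (⟨j, hj, rfl⟩ | ⟨j, hj, rfl⟩)
      · exact ⟨j, by omega, rfl⟩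
      · exact ⟨j, hj.2, rfl⟩
  · intro w
    simp only [Finset.mem_image, Finset.mem_range, Finset.mem_Ico]
    constructor
    · rintro ⟨⟨j, hj, rfl⟩, ⟨k, hk, h⟩⟩
      have := hinj _ hk.2 _ (by omega) h
      congr 1
      omega
    · rintro rfl
      exact ⟨⟨i, by omega, rfl⟩, ⟨i, ⟨le_rfl, hi⟩, rfl⟩⟩
  · simp only [Finset.mem_image, Finset.mem_range, Finset.mem_Ico]
    rintro _ ⟨j, hj, rfl⟩ _ ⟨k, hk, rfl⟩ h
    have := (hf _ (by omega) _ hk.2).1 h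
    rcases eq_or_ne j i with rfl | hji
    · exact Or.inl rfl
    · right
      congr 1
      omega
  · refine (G.isInducedPath_iff_exists_enum_s10 _).2
      ⟨i + 2, fun k => if k ≤ i then f k else v, by omega, ?_, ?_, ?_⟩
    · intro w
      simp only [Finset.mem_insert, Finset.mem_image, Finset.mem_range]
      constructor
      · rintro (rfl | ⟨j, hj, rfl⟩)
        · exact ⟨i + 1, by omega, by simp⟩
        · exact ⟨j, by omega, by simp [Nat.lt_succ_iff.1 hj]⟩
      · rintro ⟨j, hj, rfl⟩
        split_ifs with h
        · exact Or.inr ⟨j, by omega, rfl⟩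
        · exact Or.inl rfl
    · intro j hj k hk h
      dsimp only at h
      split_ifs at h with h1 h2 h2
      · exact hinj _ (by omega) _ (by omega) h
      · exact absurd h (hvf _ (by omega))
      · exact absurd h.symm (hvf _ (by omega))
      · omega
    · intro j hj k hk
      dsimp only
      split_ifs with h1 h2 h2
      · exact hf _ (by omega) _ (by omega)
      · rw [G.adj_comm, hvadj _ (by omega)]
        omega
      · rw [hvadj _ (by omega)]
        omega
      · simp only [SimpleGraph.irrefl, false_iff]
        omega
  · refine (G.isInducedPath_iff_exists_enum_s10 _).2
      ⟨n - i + 1, fun k => if k = 0 then v else f (i + k - 1), by omega, ?_, ?_, ?_⟩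
    · intro w
      simp only [Finset.mem_insert, Finset.mem_image, Finset.mem_Ico]
      constructor
      · rintro (rfl | ⟨j, hj, rfl⟩)
        · exact ⟨0, by omega, by simp⟩
        · refine ⟨j - i + 1, by omega, ?_⟩
          rw [if_neg (by omega)]
          congr 1
          omega
      · rintro ⟨j, hj, rfl⟩
        split_ifs with h
        · exact Or.inl rfl
        · exact Or.inr ⟨i + j - 1, by omega, rfl⟩
    · intro j hj k hk h
      dsimp only at h
      split_ifs at h with h1 h2 h2
      · omega
      · exact absurd h.symm (hvf _ (by omega))
      · exact absurd h (hvf _ (by omega))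
      · have := hinj _ (by omega) _ (by omega) h
        omega
    · intro j hj k hk
      dsimp only
      split_ifs with h1 h2 h2
      · simp only [SimpleGraph.irrefl, false_iff]
        omega
      · rw [hvadj _ (by omega)]
        omega
      · rw [G.adj_comm, hvadj _ (by omega)]
        omega
      · rw [hf _ (by omega) _ (by omega)]
        omega

theorem SimpleGraph.sum_smul_xi_fst {V : Type*} [Fintype V] (G : SimpleGraph V)
    (lam : Finset V → ℕ) (w : V) :
    (∑ W : Finset V, (lam W : ℝ) • G.xi W).1 w = ∑ W, (lam W : ℝ) * (G.xi W).1 w := by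
  simp [Prod.fst_sum, Finset.sum_apply]

theorem SimpleGraph.sum_smul_xi_snd {V : Type*} [Fintype V] (G : SimpleGraph V)
    (lam : Finset V → ℕ) (e : Sym2 V) :
    (∑ W : Finset V, (lam W : ℝ) • G.xi W).2 e = ∑ W, (lam W : ℝ) * (G.xi W).2 e := by
  simp [Prod.snd_sum, Finset.sum_apply]

theorem SimpleGraph.xi_snd_mk_s10 {V : Type*} (G : SimpleGraph V) (W : Finset V) (a b : V) :
    (G.xi W).2 s(a, b) = if G.Adj a b ∧ a ∈ W ∧ b ∈ W then 1 else 0 := by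
  simp [SimpleGraph.xi]

/-- The vertex part of the exchange `P, {u, v} ↦ A ∪ {v}, B ∪ {v}` gains one copy of `v`. -/
theorem SimpleGraph.xi_fst_exchange {V : Type*} (G : SimpleGraph V) {A B P : Finset V} {u v : V}
    (huv : u ≠ v) (hv : v ∉ P) (hAB : ∀ w, w ∈ P ↔ w ∈ A ∨ w ∈ B)
    (hABu : ∀ w, w ∈ A ∧ w ∈ B ↔ w = u) (w : V) :
    (G.xi (insert v A)).1 w + (G.xi (insert v B)).1 w =
      (G.xi P).1 w + (G.xi {u, v}).1 w + if w = v then 1 else 0 := by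
  have h1 := hAB w
  have h2 := hABu w
  simp only [SimpleGraph.xi, Finset.mem_insert, Finset.mem_singleton]
  by_cases hwv : w = v
  · subst hwv
    simp [hv]
  · by_cases hwA : w ∈ A <;> by_cases hwB : w ∈ B <;> simp_all

/-- The edge part of the exchange `P, {u, v} ↦ A ∪ {v}, B ∪ {v}` gains one copy of `uv`. -/
theorem SimpleGraph.xi_snd_exchange {V : Type*} (G : SimpleGraph V) {A B P : Finset V} {u v : V}
    (huv : G.Adj v u) (hv : v ∉ P) (hadj : ∀ w ∈ P, G.Adj v w ↔ w = u)
    (hAB : ∀ w, w ∈ P ↔ w ∈ A ∨ w ∈ B) (hABu : ∀ w, w ∈ A ∧ w ∈ B ↔ w = u)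
    (hnoedge : ∀ a ∈ A, ∀ b ∈ B, G.Adj a b → a = u ∨ b = u) (e : Sym2 V) :
    (G.xi (insert v A)).2 e + (G.xi (insert v B)).2 e =
      (G.xi P).2 e + (G.xi {u, v}).2 e + if e = s(u, v) then 1 else 0 := by
  have huA : u ∈ A := ((hABu u).2 rfl).1
  have huB : u ∈ B := ((hABu u).2 rfl).2
  have huv_ne : u ≠ v := huv.ne'
  have hat : ∀ b, (G.xi (insert v A)).2 s(v, b) + (G.xi (insert v B)).2 s(v, b) =
      (G.xi P).2 s(v, b) + (G.xi {u, v}).2 s(v, b) + if s(v, b) = s(u, v) then 1 else 0 := by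
    intro b
    simp only [G.xi_snd_mk_s10, Finset.mem_insert, Finset.mem_singleton]
    by_cases hbu : b = u
    · subst hbu
      simp [huv, huA, huB, hv, Sym2.eq_swap]
    · by_cases hb : G.Adj v b
      · have hbP : b ∉ P := fun h => hbu ((hadj b h).1 hb)
        have hbA : b ∉ A := fun h => hbP ((hAB b).2 (Or.inl h))
        have hbB : b ∉ B := fun h => hbP ((hAB b).2 (Or.inr h))
        simp [hbP, hbA, hbB, hbu, hb.ne', huv_ne.symm]
      · simp [hb, hbu, huv_ne.symm]
  induction e using Sym2.ind with
  | _ a b =>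
    by_cases hav : a = v
    · rw [hav]
      exact hat b
    by_cases hbv : b = v
    · rw [hbv, Sym2.eq_swap (a := a)]
      exact hat a
    simp only [G.xi_snd_mk_s10, Finset.mem_insert, Finset.mem_singleton, hav, hbv, false_or, or_false,
      Sym2.eq_iff, and_false, false_and, if_false, add_zero]
    by_cases hab : G.Adj a b
    · have hne : a ≠ b := hab.ne
      have h1 := hAB a
      have h2 := hAB b
      have h3 := hABu a
      have h4 := hABu b
      have h5 := hnoedge a
      have h6 := fun hb ha => hnoedge b hb a ha hab.symm
      by_cases haA : a ∈ A <;> by_cases haB : a ∈ B <;> by_cases hbA : b ∈ A <;>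
        by_cases hbB : b ∈ B <;> grind
    · simp [hab]

/-- If each set in the support of `lam` that contains `a` meets `K ⊆ N(a)`, then the combination
has at least as much weight on the edges from `a` to `K` as on `a`. -/
theorem SimpleGraph.sum_smul_xi_fst_le {V : Type*} [Fintype V] (G : SimpleGraph V)
    (lam : Finset V → ℕ) (a : V) (K : Finset V) (hK : ∀ w ∈ K, G.Adj a w)
    (h : ∀ W, lam W ≠ 0 → a ∈ W → ∃ w ∈ K, w ∈ W) :
    (∑ W : Finset V, (lam W : ℝ) • G.xi W).1 a ≤
      ∑ w ∈ K, (∑ W : Finset V, (lam W : ℝ) • G.xi W).2 s(a, w) := by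
  simp only [G.sum_smul_xi_fst, G.sum_smul_xi_snd]
  rw [Finset.sum_comm]
  refine Finset.sum_le_sum fun W _ => ?_
  rw [← Finset.mul_sum]
  rcases eq_or_ne (lam W) 0 with h0 | h0
  · simp [h0]
  refine mul_le_mul_of_nonneg_left ?_ (Nat.cast_nonneg _)
  have hnn : ∀ w ∈ K, 0 ≤ (G.xi W).2 s(a, w) := by
    intro w _
    rw [G.xi_snd_mk_s10]
    split_ifs <;> norm_num
  by_cases ha : a ∈ W
  · obtain ⟨w, hwK, hwW⟩ := h W h0 ha
    refine le_trans ?_ (Finset.single_le_sum hnn hwK)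
    simp [ha, hwW, hK w hwK, SimpleGraph.xi]
  · have : (G.xi W).1 a = 0 := by simp [SimpleGraph.xi, ha]
    rw [this]
    exact Finset.sum_nonneg hnn

/-- Points of the induced path cone satisfy `y(w, K) ≤ x_w` for cliques `K ⊆ N(w)`. -/
theorem SimpleGraph.sum_le_of_mem_inducedPathCone {V : Type*} [Fintype V] {G : SimpleGraph V}
    {p : (V → ℝ) × (Sym2 V → ℝ)} (hp : p ∈ G.inducedPathCone) (w : V) (K : Finset V)
    (hK : (K : Set V) ⊆ G.neighborSet w) (hc : G.IsClique (K : Set V)) :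
    ∑ u ∈ K, p.2 s(w, u) ≤ p.1 w := by
  have h1 := hp.2.2.2 w K hK hc
  have h2 : 0 ≤ ∑ u ∈ G.completeTo (insert w K), p.2 s(w, u) :=
    Finset.sum_nonneg fun u _ => hp.2.1 _
  linarith

/-- for every `u ∈ N(v)`, either `y'_{uv} = y*_{uv}` or `λ_{\{u,v\}} = 0`. -/
theorem lem_lambda_uv_zero
    {V : Type*} [Fintype V] (G : SimpleGraph V) (hG : G.Chordal)
    (v : V) (hsimp : G.IsClique (G.neighborSet v))
    (ps : (V → ℝ) × (Sym2 V → ℝ)) (hps : ps ∈ G.inducedPathCone)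
    (hintx : ∀ w, ∃ n : ℤ, ps.1 w = n) (hinty : ∀ e, ∃ n : ℤ, ps.2 e = n)
    (lam : Finset V → ℕ) (hlam : ∀ W, lam W ≠ 0 → G.IsInducedPath W)
    (p' : (V → ℝ) × (Sym2 V → ℝ)) (hp' : p' = ∑ W : Finset V, (lam W : ℝ) • G.xi W)
    (hle1 : ∀ w, p'.1 w ≤ ps.1 w) (hle2 : ∀ e, p'.2 e ≤ ps.2 e)
    (heq1 : ∀ w, w ≠ v → p'.1 w = ps.1 w)
    (heq2 : ∀ e : Sym2 V, v ∉ e → p'.2 e = ps.2 e)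
    (hmin : ∀ (mu : Finset V → ℕ) (q : (V → ℝ) × (Sym2 V → ℝ)),
      q = ∑ W : Finset V, (mu W : ℝ) • G.xi W →
      (∀ W, mu W ≠ 0 → G.IsInducedPath W) →
      (∀ w, q.1 w ≤ ps.1 w) → (∀ e, q.2 e ≤ ps.2 e) →
      (∀ w, w ≠ v → q.1 w = ps.1 w) →
      (∀ e : Sym2 V, v ∉ e → q.2 e = ps.2 e) →
      ∑ u ∈ G.nbrF v, (ps.2 s(u, v) - p'.2 s(u, v)) ≤
        ∑ u ∈ G.nbrF v, (ps.2 s(u, v) - q.2 s(u, v))) :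
    ∀ u ∈ G.nbrF v,
      p'.2 s(u, v) = ps.2 s(u, v) ∨ lam {u, v} = 0 := by
  intro u hu
  by_contra! hcon
  obtain ⟨hgap_ne, hlamuv⟩ := hcon
  have huv : G.Adj v u := by simpa [SimpleGraph.nbrF] using hu
  have huv_ne : u ≠ v := huv.ne'
  have hgap : p'.2 s(u, v) + 1 ≤ ps.2 s(u, v) := by
    obtain ⟨m, hm⟩ := hinty s(u, v)
    have hnat : p'.2 s(u, v) =
        ((∑ W : Finset V, lam W * (if u ∈ W ∧ v ∈ W then 1 else 0) : ℕ) : ℝ) := by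
      rw [hp', G.sum_smul_xi_snd]
      push_cast
      refine Finset.sum_congr rfl fun W _ => ?_
      simp [G.xi_snd_mk_s10, huv.symm]
    have hlt : p'.2 s(u, v) < ps.2 s(u, v) := lt_of_le_of_ne (hle2 _) hgap_ne
    rw [hnat, hm] at hlt ⊢
    exact_mod_cast hlt
  have hadjN : ∀ w ∈ G.nbrF v, G.Adj v w := fun w hw => by simpa [SimpleGraph.nbrF] using hw
  obtain ⟨P, hP0, huP, hvP, hPN⟩ : ∃ P, lam P ≠ 0 ∧ u ∈ P ∧ v ∉ P ∧
      ∀ w ∈ P, G.Adj v w ↔ w = u := by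
    by_contra! hno
    set K : Finset V := insert v ((G.nbrF v).erase u) with hKdef
    have hKadj : ∀ w ∈ K, G.Adj u w := by
      intro w hw
      rcases Finset.mem_insert.1 hw with rfl | hw
      · exact huv.symm
      · obtain ⟨hwu, hw⟩ := Finset.mem_erase.1 hw
        exact hsimp huv (hadjN w hw) hwu.symm
    have hKc : G.IsClique (K : Set V) := by
      rw [hKdef, Finset.coe_insert, SimpleGraph.isClique_insert]
      refine ⟨hsimp.subset fun w hw => ?_, fun w hw _ => ?_⟩
      · exact hadjN w (Finset.mem_of_mem_erase hw)
      · exact hadjN w (Finset.mem_of_mem_erase hw)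
    have h1 := SimpleGraph.sum_le_of_mem_inducedPathCone hps u K hKadj hKc
    have h2 := G.sum_smul_xi_fst_le lam u K hKadj (fun W hW huW => by
      by_contra! hdis
      have hvW : v ∉ W := hdis v (Finset.mem_insert_self _ _)
      obtain ⟨w, hwW, hw⟩ := hno W hW huW hvW
      rcases hw with ⟨hvw, hwu⟩ | ⟨hvw, rfl⟩
      · exact hdis w (by simp [hKdef, SimpleGraph.nbrF, hvw, hwu]) hwW
      · exact hvw huv)
    rw [← hp', heq1 u huv_ne] at h2
    have h3 : ∑ w ∈ K, p'.2 s(u, w) < ∑ w ∈ K, ps.2 s(u, w) :=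
      Finset.sum_lt_sum (fun w _ => hle2 _) ⟨v, Finset.mem_insert_self _ _, by linarith⟩
    linarith
  obtain ⟨A, B, hAB, hABu, hnoedge, hA, hB⟩ := (hlam P hP0).exists_split huP hvP hPN
  obtain ⟨c, hc1, hc2, hc3⟩ : ∃ c : ℕ, c ≤ 1 ∧ c ≤ lam {v} ∧ p'.1 v + 1 - c ≤ ps.1 v := by
    rcases Nat.eq_zero_or_pos (lam {v}) with h0 | hpos
    · refine ⟨0, by omega, by omega, ?_⟩
      have h1 := SimpleGraph.sum_le_of_mem_inducedPathCone hps v (G.nbrF v) hadjN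
        (hsimp.subset hadjN)
      have h2 := G.sum_smul_xi_fst_le lam v (G.nbrF v) hadjN (fun W hW hvW => by
        obtain ⟨w, hw, hvw⟩ := (hlam W hW).exists_adj hvW (by rintro rfl; exact hW h0)
        exact ⟨w, by simp [SimpleGraph.nbrF, hvw], hw⟩)
      rw [← hp', ← Finset.add_sum_erase _ _ hu] at h2
      rw [← Finset.add_sum_erase _ _ hu] at h1
      have h3 : ∑ w ∈ (G.nbrF v).erase u, p'.2 s(v, w) ≤ ∑ w ∈ (G.nbrF v).erase u, ps.2 s(v, w) :=
        Finset.sum_le_sum fun w _ => hle2 _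
      rw [Sym2.eq_swap] at hgap
      push_cast
      linarith
    · exact ⟨1, le_rfl, hpos, by simpa using hle1 v⟩
  have hPuv : P ≠ {u, v} := by rintro rfl; simp at hvP
  have hPv : P ≠ {v} := by rintro rfl; simp at hvP
  have huvv : ({u, v} : Finset V) ≠ {v} := fun h =>
    huv_ne (Finset.mem_singleton.1 (h ▸ Finset.mem_insert_self u {v}))
  let mu : Finset V → ℕ := fun W =>
    lam W + (if W = insert v A then 1 else 0) + (if W = insert v B then 1 else 0)
      - ((if W = P then 1 else 0) + (if W = {u, v} then 1 else 0) + (if W = {v} then c else 0))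
  have hmu : ∀ W, (mu W : ℝ) =
      lam W + (if W = insert v A then 1 else 0) + (if W = insert v B then 1 else 0)
      - ((if W = P then 1 else 0) + (if W = {u, v} then 1 else 0) +
        (if W = {v} then (c : ℝ) else 0)) := by
    intro W
    have hle : (if W = P then 1 else 0) + (if W = {u, v} then 1 else 0) +
        (if W = {v} then c else 0) ≤ lam W := by
      by_cases h1 : W = P
      · subst h1
        simp only [hPuv, hPv, if_true, if_false]
        omega
      by_cases h2 : W = {u, v}
      · subst h2
        simp only [hPuv.symm, huvv, if_true, if_false]
        omega
      by_cases h3 : W = {v}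
      · subst h3
        simp only [hPv.symm, huvv.symm, if_true, if_false]
        omega
      · simp [h1, h2, h3]
    simp only [mu]
    rw [Nat.cast_sub (by omega)]
    push_cast
    ring
  have hsum : ∀ F : Finset V → ℝ, ∑ W, (mu W : ℝ) * F W =
      ∑ W, (lam W : ℝ) * F W + F (insert v A) + F (insert v B) - F P - F {u, v} - c * F {v} := by
    intro F
    simp only [hmu, sub_mul, add_mul, Finset.sum_sub_distrib, Finset.sum_add_distrib, ite_mul,
      one_mul, zero_mul, Finset.sum_ite_eq', Finset.mem_univ, if_true]
    ring
  have hfst : ∀ w, (∑ W : Finset V, (mu W : ℝ) • G.xi W).1 w =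
      p'.1 w + if w = v then 1 - (c : ℝ) else 0 := by
    intro w
    rw [hp', G.sum_smul_xi_fst, G.sum_smul_xi_fst, hsum]
    have h1 := G.xi_fst_exchange huv_ne hvP hAB hABu w
    have h2 : (c : ℝ) * (G.xi {v}).1 w = if w = v then (c : ℝ) else 0 := by
      simp [SimpleGraph.xi]
    rw [h2]
    split_ifs at h1 ⊢ <;> linarith
  have hsnd : ∀ e, (∑ W : Finset V, (mu W : ℝ) • G.xi W).2 e =
      p'.2 e + if e = s(u, v) then 1 else 0 := by
    intro e
    rw [hp', G.sum_smul_xi_snd, G.sum_smul_xi_snd, hsum]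
    have h1 := G.xi_snd_exchange huv hvP hPN hAB hABu hnoedge e
    have h2 : (G.xi {v}).2 e = 0 := by
      induction e using Sym2.ind with
      | _ a b =>
        rw [G.xi_snd_mk_s10, if_neg]
        simp only [Finset.mem_singleton]
        rintro ⟨h, rfl, rfl⟩
        exact h.ne rfl
    rw [h2]
    linarith
  have hfinal := hmin mu _ rfl ?_ ?_ ?_ ?_ ?_
  · simp only [hsnd] at hfinal
    have hlt : ∑ w ∈ G.nbrF v, (ps.2 s(w, v) -
        (p'.2 s(w, v) + if s(w, v) = s(u, v) then 1 else 0)) <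
        ∑ w ∈ G.nbrF v, (ps.2 s(w, v) - p'.2 s(w, v)) := by
      refine Finset.sum_lt_sum (fun w _ => ?_) ⟨u, hu, by simp⟩
      split_ifs <;> linarith
    linarith
  · intro W hW
    by_cases h1 : W = insert v A
    · exact h1 ▸ hA
    by_cases h2 : W = insert v B
    · exact h2 ▸ hB
    refine hlam W fun h0 => hW ?_
    simp [mu, h1, h2, h0]
  · intro w
    rw [hfst]
    split_ifs with h
    · subst h
      linarith
    · linarith [hle1 w]
  · intro e
    rw [hsnd]
    split_ifs with h
    · rw [h]
      exact hgap
    · linarith [hle2 e]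
  · intro w hw
    rw [hfst, if_neg hw, add_zero, heq1 w hw]
  · intro e he
    rw [hsnd, if_neg (by rintro rfl; simp at he), add_zero, heq2 e he]
end

section
/- Let G be a finite simple chordal graph. Then the extended incidence vectors of the induced paths of G form a Hilbert basis of the induced path cone C_P(G): every integer point (x,y) ∈ Z^V × Z^E lying in C_P(G) can be written as a nonnegative integer combination of extended incidence vectors of induced paths of G. -/
open SimpleGraph Finset
open scoped Classical

namespace SimpleGraph

/-- In a chordal graph, a walk in which vertices at distance two along the walk are distinct and
nonadjacent is an induced path. -/
lemma Chordal.induced_of_locally_induced {V : Type*} {G : SimpleGraph V} (hG : G.Chordal)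
    (g : ℕ → V) (n : ℕ) (h₁ : ∀ i, i + 1 ≤ n → G.Adj (g i) (g (i + 1)))
    (h₂ : ∀ i, i + 2 ≤ n → g i ≠ g (i + 2) ∧ ¬ G.Adj (g i) (g (i + 2))) {i j : ℕ}
    (hij : i < j) (hj : j ≤ n) : g i ≠ g j ∧ (G.Adj (g i) (g j) → j = i + 1) := by
  induction hd : j - i using Nat.strong_induction_on generalizing i j with
  | _ d ih =>
  have ih' : ∀ a b, i ≤ a → b ≤ j → a < b → b - a < d →
      g a ≠ g b ∧ (G.Adj (g a) (g b) → b = a + 1) :=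
    fun a b _ hb hab hlt => ih _ hlt hab (hb.trans hj) rfl
  rcases (by omega : j = i + 1 ∨ j = i + 2 ∨ i + 3 ≤ j) with rfl | rfl | h3
  · exact ⟨(h₁ i hj).ne, fun _ => rfl⟩
  · exact ⟨(h₂ i hj).1, fun h => absurd h (h₂ i hj).2⟩
  have hne : g i ≠ g j := by
    intro he
    have hadj := h₁ (j - 1) (by omega)
    rw [Nat.sub_add_cancel (by omega), ← he] at hadj
    have := (ih' i (j - 1) le_rfl (by omega) (by omega) (by omega)).2 hadj.symm
    omega
  refine ⟨hne, fun hadj => (hG ?_).elim⟩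
  have hdist : ∀ a b, i ≤ a → b ≤ j → a < b → g a ≠ g b := by
    intro a b ha hb hab
    by_cases h : b - a < d
    · exact (ih' a b ha hb hab h).1
    · obtain rfl : a = i := by omega
      obtain rfl : b = j := by omega
      exact hne
  have hadj_iff : ∀ a b, i ≤ a → b ≤ j → a < b →
      (G.Adj (g a) (g b) ↔ b = a + 1 ∨ (a = i ∧ b = j)) := by
    intro a b ha hb hab
    constructor
    · intro h
      by_cases hlt : b - a < d
      · exact Or.inl ((ih' a b ha hb hab hlt).2 h)
      · right; omega
    · rintro (rfl | ⟨rfl, rfl⟩)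
      · exact h₁ a (by omega)
      · exact hadj
  let f : Fin (j - i + 1) → g '' Set.Icc i j :=
    fun k => ⟨g (i + k), i + k, ⟨by omega, by omega⟩, rfl⟩
  have hf : Function.Bijective f := by
    constructor
    · intro a b hab
      have hab' : g (i + a) = g (i + b) := congrArg Subtype.val hab
      ext
      rcases lt_trichotomy (a : ℕ) b with h | h | h
      · exact absurd hab' (hdist _ _ (by omega) (by omega) (by omega))
      · exact h
      · exact absurd hab'.symm (hdist _ _ (by omega) (by omega) (by omega))
    · rintro ⟨_, k, hk, rfl⟩
      refine ⟨⟨k - i, by have := hk.2; omega⟩, Subtype.ext ?_⟩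
      simp [f, Nat.add_sub_cancel' hk.1]
  have hcyc : ∀ a b : Fin (j - i + 1), a < b →
      ((cycleGraph (j - i + 1)).Adj a b ↔ G.Adj (g (i + a)) (g (i + b))) := by
    intro a b hab
    have hab' : (a : ℕ) < b := hab
    rw [hadj_iff _ _ (by omega) (by omega) (by omega), cycleGraph_adj',
      Fin.coe_sub_iff_lt.2 hab, Fin.coe_sub_iff_le.2 hab.le]
    omega
  refine ⟨g '' Set.Icc i j, j - i + 1, by omega, ⟨RelIso.symm ⟨Equiv.ofBijective f hf, ?_⟩⟩⟩
  intro a b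
  rcases lt_trichotomy a b with h | rfl | h
  · exact (hcyc a b h).symm
  · simp
  · rw [SimpleGraph.adj_comm, (cycleGraph _).adj_comm]
    exact (hcyc b a h).symm

/-- A form of Tutte's theorem for graphs with no induced pair of disjoint edges. -/
lemma exists_isPerfectMatching_of_two_edges {T : Type*} [Fintype T] (H : SimpleGraph T)
    (heven : Even (Fintype.card T))
    (hH : ∀ a b c d, H.Adj a b → H.Adj c d → H.Adj a c ∨ H.Adj a d ∨ H.Adj b c ∨ H.Adj b d)
    (hI : ∀ I : Finset T, (∀ a ∈ I, ∀ b ∈ I, ¬ H.Adj a b) →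
      2 * #I + #{c | c ∉ I ∧ ∀ a ∈ I, ¬ H.Adj a c} ≤ Fintype.card T) :
    ∃ M : H.Subgraph, M.IsPerfectMatching := by
  rw [tutte]
  intro U hU
  unfold IsTutteViolator at hU
  set D := ((⊤ : H.Subgraph).deleteVerts U).coe with hD
  have hpar := D.odd_ncard_oddComponents
  have hcardD : Nat.card ((⊤ : H.Subgraph).deleteVerts U).verts + U.ncard = Fintype.card T := by
    have := Set.ncard_add_ncard_compl U
    rw [Nat.card_eq_fintype_card] at this
    rw [Nat.card_coe_set_eq, ← this, add_comm]
    congr 2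
    ext; simp
  let I : Finset T := {a | a ∉ U ∧ ∀ b, b ∉ U → ¬ H.Adj a b}
  have hI' := hI I (fun a ha b hb => by
    simp only [I, mem_filter, mem_univ, true_and] at ha hb
    exact ha.2 b hb.1)
  have hIU : #I ≤ U.ncard := by
    have hsub : (univ : Finset T) ⊆ U.toFinset ∪ I ∪
        ({c | c ∉ I ∧ ∀ a ∈ I, ¬ H.Adj a c} : Finset T) := by
      intro c _
      by_cases hc : c ∈ U
      · simp [hc]
      by_cases hcI : c ∈ I
      · simp [hcI]
      · have : ∀ a ∈ I, ¬ H.Adj a c := fun a ha => by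
          simp only [I, mem_filter, mem_univ, true_and] at ha
          exact ha.2 c hc
        simpa [hcI] using Or.inr this
    have h1 := card_le_card hsub
    have h2 := card_union_le (U.toFinset ∪ I) ({c | c ∉ I ∧ ∀ a ∈ I, ¬ H.Adj a c} : Finset T)
    have h3 := card_union_le U.toFinset I
    rw [Set.ncard_eq_toFinset_card']
    rw [card_univ] at h1
    omega
  have hodd : D.oddComponents.ncard ≤ #I + 1 := by
    have hle : D.oddComponents.ncard ≤ Nat.card D.ConnectedComponent := by
      rw [← Set.ncard_univ]
      exact Set.ncard_le_ncard (Set.subset_univ _)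
    refine hle.trans ?_
    have : #I + 1 = Nat.card (Option I) := by simp
    rw [this]
    refine Nat.card_le_card_of_injective
      (fun C => if h : (C.out : T) ∈ I then some ⟨_, h⟩ else none) ?_
    intro C C' h
    dsimp only at h
    split_ifs at h with h1 h2 h2
    · simp only [Option.some.injEq, Subtype.mk.injEq] at h
      rw [← Quot.out_eq C, ← Quot.out_eq C', Subtype.ext h]
    · rw [← Quot.out_eq C, ← Quot.out_eq C']
      have hadj : ∀ a b : ((⊤ : H.Subgraph).deleteVerts U).verts, D.Adj a b ↔ H.Adj a b := by
        rintro ⟨a, ha⟩ ⟨b, hb⟩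
        simp at ha hb
        simp [hD, ha, hb]
      have key : ∀ a : ((⊤ : H.Subgraph).deleteVerts U).verts, (a : T) ∉ I →
          ∃ b : ((⊤ : H.Subgraph).deleteVerts U).verts, H.Adj a b := by
        rintro ⟨a, ha⟩ haI
        simp at ha
        simp only [I, mem_filter, mem_univ, true_and, not_and, not_forall, not_not] at haI
        obtain ⟨b, hb, hab⟩ := haI ha
        exact ⟨⟨b, by simpa using hb⟩, hab⟩
      obtain ⟨b, hb⟩ := key _ h1
      obtain ⟨d, hd⟩ := key _ h2
      refine ConnectedComponent.sound ?_
      have hb' := ((hadj _ _).2 hb).reachable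
      have hd' := ((hadj _ _).2 hd).reachable
      rcases hH _ _ _ _ hb hd with h | h | h | h
      · exact ((hadj _ _).2 h).reachable
      · exact ((hadj _ _).2 h).reachable.trans hd'.symm
      · exact hb'.trans ((hadj _ _).2 h).reachable
      · exact (hb'.trans ((hadj _ _).2 h).reachable).trans hd'.symm
  rw [← Nat.not_even_iff_odd, ← Nat.not_even_iff_odd, not_iff_not, Nat.even_iff,
    Nat.even_iff] at hpar
  rw [Nat.even_iff] at heven
  omega

/-- The endpoints of a perfect matching can be labelled by `x` labels, one per edge, if there are
`2 * x` vertices. -/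
lemma Subgraph.IsPerfectMatching.exists_labelling {T : Type*} [Fintype T] {H : SimpleGraph T}
    {M : H.Subgraph} (hM : M.IsPerfectMatching) {x : ℕ} (hx : Fintype.card T = 2 * x) :
    ∃ c : T → Fin x, ∀ a b, c a = c b → a = b ∨ M.Adj a b := by
  have hcard : #M.spanningCoe.edgeFinset = x := by
    have h := M.spanningCoe.sum_degrees_eq_twice_card_edges
    have hdeg : ∀ v, M.spanningCoe.degree v = 1 := by
      intro v
      rw [Subgraph.degree_spanningCoe]
      exact Subgraph.isPerfectMatching_iff_forall_degree.1 hM v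
    simp only [hdeg, sum_const, card_univ, smul_eq_mul, mul_one] at h
    omega
  choose m hm using fun v => (Subgraph.isPerfectMatching_iff.1 hM v).exists
  have hmem : ∀ a, s(a, m a) ∈ M.spanningCoe.edgeFinset := fun a => by simpa using hm a
  refine ⟨fun a => finCongr hcard (M.spanningCoe.edgeFinset.equivFin ⟨s(a, m a), hmem a⟩), ?_⟩
  intro a b hab
  simp only [EmbeddingLike.apply_eq_iff_eq, Subtype.mk.injEq, Sym2.eq_iff] at hab
  rcases hab with h | h
  · exact Or.inl h.1
  · right; rw [← h.2]; exact hm a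


/-- Finset of elements of the first summand lying over `S`. -/
def sigmaOver {V : Type*} (y : V → ℕ) (k : ℕ) (S : Finset V) :
    Finset ((Σ u, Fin (y u)) ⊕ Fin k) :=
  (S.sigma fun _ => univ).map Function.Embedding.inl

lemma card_sigmaOver {V : Type*} (y : V → ℕ) (k : ℕ) (S : Finset V) :
    #(sigmaOver y k S) = ∑ u ∈ S, y u := by
  simp [sigmaOver]

/-- The graph on `y u` copies of every vertex `u` of `G` and `k` further universal vertices, in
which copies of `u` and `v` are joined when `u` and `v` are distinct and nonadjacent in `G`. -/
def compatGraph {V : Type*} (G : SimpleGraph V) (y : V → ℕ) (k : ℕ) :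
    SimpleGraph ((Σ u, Fin (y u)) ⊕ Fin k) where
  Adj a b := a ≠ b ∧ ∀ s t, a = Sum.inl s → b = Sum.inl t → s.1 ≠ t.1 ∧ ¬ G.Adj s.1 t.1
  symm := ⟨fun _ _ h => ⟨h.1.symm, fun s t hs ht =>
    ⟨(h.2 t s ht hs).1.symm, fun h' => (h.2 t s ht hs).2 h'.symm⟩⟩⟩
  loopless := ⟨fun _ h => h.1 rfl⟩

lemma exists_of_not_compatGraph_adj {V : Type*} {G : SimpleGraph V} {y : V → ℕ} {k : ℕ}
    {a b : (Σ u, Fin (y u)) ⊕ Fin k} (hab : a ≠ b) (h : ¬ (compatGraph G y k).Adj a b) :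
    ∃ s t, a = Sum.inl s ∧ b = Sum.inl t ∧ (s.1 = t.1 ∨ G.Adj s.1 t.1) := by
  by_contra hcon
  refine h ⟨hab, fun s t hs ht => ?_⟩
  by_contra h'
  exact hcon ⟨s, t, hs, ht, by tauto⟩

lemma Chordal.false_of_four_cycle {V : Type*} {G : SimpleGraph V} (hG : G.Chordal) {a b c d : V}
    (hac : G.Adj a c) (hcb : G.Adj c b) (hbd : G.Adj b d) (hda : G.Adj d a)
    (hab : a ≠ b ∧ ¬ G.Adj a b) (hcd : c ≠ d ∧ ¬ G.Adj c d) : False := by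
  let g : ℕ → V := fun i => if i = 0 then a else if i = 1 then c else if i = 2 then b
    else if i = 3 then d else a
  refine (hG.induced_of_locally_induced g 4 ?_ ?_ (i := 0) (j := 4) (by omega) le_rfl).1 rfl
  · intro i hi
    have : i < 4 := by omega
    interval_cases i <;> simp [g] <;> assumption
  · intro i hi
    have : i < 3 := by omega
    interval_cases i
    · exact hab
    · exact hcd
    · exact ⟨hab.1.symm, fun h => hab.2 h.symm⟩

lemma Chordal.compatGraph_two_edges {V : Type*} {G : SimpleGraph V} (hG : G.Chordal) (y : V → ℕ)
    (k : ℕ) (a b c d : (Σ u, Fin (y u)) ⊕ Fin k) (hab : (compatGraph G y k).Adj a b)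
    (hcd : (compatGraph G y k).Adj c d) :
    (compatGraph G y k).Adj a c ∨ (compatGraph G y k).Adj a d ∨
      (compatGraph G y k).Adj b c ∨ (compatGraph G y k).Adj b d := by
  by_contra! hcon
  obtain ⟨hac, had, hbc, hbd⟩ := hcon
  have hac' : a ≠ c := by rintro rfl; exact had hcd
  have had' : a ≠ d := by rintro rfl; exact hac hcd.symm
  have hbc' : b ≠ c := by rintro rfl; exact hbd hcd
  have hbd' : b ≠ d := by rintro rfl; exact hbc hcd.symm
  obtain ⟨s, t, rfl, rfl, hst⟩ := exists_of_not_compatGraph_adj hac' hac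
  obtain ⟨_, v, hs, rfl, hsv⟩ := exists_of_not_compatGraph_adj had' had
  obtain rfl := Sum.inl_injective hs
  obtain ⟨u, _, rfl, ht, hut⟩ := exists_of_not_compatGraph_adj hbc' hbc
  obtain rfl := Sum.inl_injective ht
  obtain ⟨_, _, hu, hv, huv⟩ := exists_of_not_compatGraph_adj hbd' hbd
  obtain rfl := Sum.inl_injective hu
  obtain rfl := Sum.inl_injective hv
  have h1 := hab.2 _ _ rfl rfl
  have h2 := hcd.2 _ _ rfl rfl
  have e1 : s.1 ≠ t.1 := fun h => by
    rw [h] at hsv; exact hsv.elim h2.1 h2.2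
  have e2 : s.1 ≠ v.1 := fun h => by
    rw [h] at hst; exact hst.elim h2.1.symm fun h => h2.2 h.symm
  have e3 : u.1 ≠ t.1 := fun h => by
    rw [h] at huv; exact huv.elim h2.1 h2.2
  have e4 : u.1 ≠ v.1 := fun h => by
    rw [h] at hut; exact hut.elim h2.1.symm fun h => h2.2 h.symm
  exact hG.false_of_four_cycle (hst.resolve_left e1) (hut.resolve_left e3).symm
    (huv.resolve_left e4) (hsv.resolve_left e2).symm h1 h2

/-- The inequalities of the induced path cone at `w` bound the independent sets of the graph of
compatible edge ends at `w`. -/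
lemma compatGraph_independent_bound {V : Type*} [Fintype V] {G : SimpleGraph V} {w : V}
    {y : V → ℕ} {x k : ℕ} (hcard : ∑ u, y u + k = 2 * x) (hy : ∀ u, y u ≠ 0 → G.Adj w u)
    (hK : ∀ K : Finset V, (K : Set V) ⊆ G.neighborSet w → G.IsClique (K : Set V) →
      ∑ u ∈ G.completeTo (insert w K), y u + 2 * ∑ u ∈ K, y u ≤ 2 * x)
    (I : Finset ((Σ u, Fin (y u)) ⊕ Fin k))
    (hI : ∀ a ∈ I, ∀ b ∈ I, ¬ (compatGraph G y k).Adj a b) :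
    2 * #I + #{c | c ∉ I ∧ ∀ a ∈ I, ¬ (compatGraph G y k).Adj a c} ≤ 2 * x := by
  have hadj : ∀ s : Σ u, Fin (y u), G.Adj w s.1 := fun s => hy _ (by have := s.2.2; omega)
  rcases I.eq_empty_or_nonempty with rfl | ⟨a₀, ha₀⟩
  · simp [hcard]
  by_cases hz : ∃ z : Fin k, Sum.inr z ∈ I
  · obtain ⟨z, hz⟩ := hz
    have hnot : ∀ b, b ≠ Sum.inr z → (compatGraph G y k).Adj (Sum.inr z) b :=
      fun b hb => ⟨hb.symm, fun s t hs => by simp at hs⟩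
    have hIz : I = {Sum.inr z} := by
      refine eq_singleton_iff_unique_mem.2 ⟨hz, fun b hb => ?_⟩
      by_contra hne
      exact hI _ hz _ hb (hnot b hne)
    have hC : ({c | c ∉ I ∧ ∀ a ∈ I, ¬ (compatGraph G y k).Adj a c} : Finset _) = ∅ := by
      refine filter_eq_empty_iff.2 fun b _ hb => hb.2 _ hz (hnot b ?_)
      rintro rfl
      exact hb.1 hz
    rw [hC, hIz]
    have : 0 < k := z.pos
    simp
    omega
  · let K : Finset V := {u | ∃ s, Sum.inl s ∈ I ∧ s.1 = u}
    have hmemK : ∀ u, u ∈ K ↔ ∃ s, Sum.inl s ∈ I ∧ s.1 = u := by simp [K]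
    have hKw : (K : Set V) ⊆ G.neighborSet w := by
      intro u hu
      obtain ⟨s, -, rfl⟩ := (hmemK u).1 hu
      exact hadj s
    have hKc : G.IsClique (K : Set V) := by
      intro u hu v hv huv
      obtain ⟨s, hs, rfl⟩ := (hmemK u).1 hu
      obtain ⟨t, ht, rfl⟩ := (hmemK v).1 hv
      have hst : (Sum.inl s : _ ⊕ Fin k) ≠ Sum.inl t := fun h =>
        huv (by rw [Sum.inl_injective h])
      obtain ⟨_, _, hs', ht', h⟩ := exists_of_not_compatGraph_adj hst (hI _ hs _ ht)
      obtain rfl := Sum.inl_injective hs'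
      obtain rfl := Sum.inl_injective ht'
      exact h.resolve_left huv
    have hIA : I ⊆ sigmaOver y k K := by
      rintro (s | z) ha
      · simpa [sigmaOver] using (hmemK _).2 ⟨s, ha, rfl⟩
      · exact absurd ⟨z, ha⟩ hz
    have hsub : ({c | c ∉ I ∧ ∀ a ∈ I, ¬ (compatGraph G y k).Adj a c} : Finset _) ⊆
        (sigmaOver y k K \ I) ∪ sigmaOver y k (G.completeTo (insert w K)) := by
      intro c hc
      simp only [mem_filter, mem_univ, true_and] at hc
      obtain ⟨hcI, hc⟩ := hc
      obtain ⟨-, t, -, rfl, -⟩ := exists_of_not_compatGraph_adj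
        (by rintro rfl; exact hcI ha₀) (hc _ ha₀)
      by_cases htK : t.1 ∈ K
      · simp [sigmaOver, htK, hcI]
      · refine mem_union_right _ ?_
        have : t.1 ∈ G.completeTo (insert w K) := by
          simp only [completeTo, mem_filter, mem_univ, true_and, mem_insert, not_or,
            forall_eq_or_imp]
          refine ⟨⟨(hadj t).ne', htK⟩, (hadj t).symm, fun u hu => ?_⟩
          obtain ⟨s, hs, rfl⟩ := (hmemK u).1 hu
          obtain ⟨_, _, hs', ht', h⟩ := exists_of_not_compatGraph_adj
            (by rintro h; exact hcI (h ▸ hs)) (hc _ hs)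
          obtain rfl := Sum.inl_injective hs'
          obtain rfl := Sum.inl_injective ht'
          refine (h.resolve_left ?_).symm
          intro h
          exact htK (h ▸ hu)
        simpa [sigmaOver] using this
    have h1 := card_le_card hsub
    have h2 := card_union_le (sigmaOver y k K \ I) (sigmaOver y k (G.completeTo (insert w K)))
    have h3 := card_sdiff_add_card_eq_card hIA
    have h4 := hK K hKw hKc
    rw [← card_sigmaOver y k, ← card_sigmaOver y k] at h4
    omega

/-- If the inequalities of the induced path cone hold at a vertex `w` of a chordal graph, then the
`y u` edge ends at `w` towards its neighbours `u` can be distributed over `x` copies of `w`, each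
copy receiving at most two of them, and these towards distinct nonadjacent neighbours. -/
lemma Chordal.exists_local_labelling {V : Type*} [Fintype V] {G : SimpleGraph V} (hG : G.Chordal)
    (w : V) (y : V → ℕ) (x : ℕ) (hy : ∀ u, y u ≠ 0 → G.Adj w u)
    (hK : ∀ K : Finset V, (K : Set V) ⊆ G.neighborSet w → G.IsClique (K : Set V) →
      ∑ u ∈ G.completeTo (insert w K), y u + 2 * ∑ u ∈ K, y u ≤ 2 * x) :
    ∃ c : V × ℕ → ℕ, (∀ d, d.2 < y d.1 → c d < x) ∧
      (∀ d d', d.2 < y d.1 → d'.2 < y d'.1 → c d = c d' →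
        d = d' ∨ d.1 ≠ d'.1 ∧ ¬ G.Adj d.1 d'.1) ∧
      (∀ d₁ d₂ d₃, d₁.2 < y d₁.1 → d₂.2 < y d₂.1 → d₃.2 < y d₃.1 → c d₁ = c d₂ → c d₁ = c d₃ →
        d₁ = d₂ ∨ d₁ = d₃ ∨ d₂ = d₃) := by
  have hle : ∑ u, y u ≤ 2 * x := by
    have h := hK ∅ (by simp) (by simp)
    rw [sum_empty, mul_zero, add_zero] at h
    rwa [sum_subset (subset_univ _)] at h
    intro u _ hu
    by_contra h0
    exact hu (by simpa [completeTo] using ⟨(hy u h0).ne', (hy u h0).symm⟩)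
  obtain ⟨k, hk⟩ := Nat.exists_eq_add_of_le hle
  have hT : Fintype.card ((Σ u, Fin (y u)) ⊕ Fin k) = 2 * x := by simp [hk]
  obtain ⟨M, hM⟩ := exists_isPerfectMatching_of_two_edges (compatGraph G y k) (by simp [hT])
    (hG.compatGraph_two_edges y k)
    (fun I hI => by rw [hT]; convert compatGraph_independent_bound hk.symm hy hK I hI)
  obtain ⟨c, hc⟩ := hM.exists_labelling hT
  have hinj : ∀ d d' : V × ℕ, ∀ (h : d.2 < y d.1) (h' : d'.2 < y d'.1),
      (⟨d.1, d.2, h⟩ : Σ u, Fin (y u)) = ⟨d'.1, d'.2, h'⟩ → d = d' := by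
    rintro ⟨u, i⟩ ⟨v, j⟩ h h' he
    obtain ⟨rfl, he⟩ := Sigma.mk.inj_iff.1 he
    simpa using he
  refine ⟨fun d => if h : d.2 < y d.1 then c (Sum.inl ⟨d.1, d.2, h⟩) else 0, ?_, ?_, ?_⟩
  · intro d hd
    simp [hd]
  · intro d d' hd hd' h
    simp only [hd, hd', dite_true, Fin.val_inj] at h
    refine (hc _ _ h).imp (fun h => hinj _ _ hd hd' (Sum.inl_injective h)) fun h => ?_
    exact (M.adj_sub h).2 _ _ rfl rfl
  · intro d₁ d₂ d₃ h₁ h₂ h₃ h h'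
    simp only [h₁, h₂, h₃, dite_true, Fin.val_inj] at h h'
    rcases hc _ _ h with h | h
    · exact Or.inl (hinj _ _ h₁ h₂ (Sum.inl_injective h))
    rcases hc _ _ h' with h' | h'
    · exact Or.inr (Or.inl (hinj _ _ h₁ h₃ (Sum.inl_injective h')))
    · exact Or.inr (Or.inr (hinj _ _ h₂ h₃ (Sum.inl_injective (hM.1.eq_of_adj_left h h'))))

/-- In a finite graph of maximum degree at most two, every component is traversed by a path. -/
lemma exists_isPath_support_of_degree_le_two {N : Type*} [Fintype N] (F : SimpleGraph N)
    (hdeg : ∀ a b₁ b₂ b₃, F.Adj a b₁ → F.Adj a b₂ → F.Adj a b₃ → b₁ = b₂ ∨ b₁ = b₃ ∨ b₂ = b₃)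
    (a : N) : ∃ (u v : N) (p : F.Walk u v), p.IsPath ∧ ∀ b, F.Reachable a b ↔ b ∈ p.support := by
  let P : ℕ → Prop := fun n => ∃ (u v : N) (p : F.Walk u v),
    p.IsPath ∧ a ∈ p.support ∧ p.length = n
  have hP0 : P 0 := ⟨a, a, .nil, by simp, by simp, rfl⟩
  have hbound : ∀ n, P n → n ≤ Fintype.card N := by
    rintro _ ⟨u, v, p, hp, -, rfl⟩
    exact hp.length_lt.le
  obtain ⟨u, v, p, hp, hap, hlen⟩ := Nat.findGreatest_spec (Nat.zero_le _) hP0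
  have hmax : ∀ n, P n → n ≤ p.length := fun n hn =>
    hlen ▸ Nat.le_findGreatest (hbound n hn) hn
  refine ⟨u, v, p, hp, fun b => ⟨fun hab => ?_, fun hb =>
    (p.takeUntil a hap).reachable.symm.trans (p.takeUntil b hb).reachable⟩⟩
  have hclosed : ∀ b d, b ∈ p.support → F.Adj b d → d ∈ p.support := by
    intro b d hb hbd
    by_contra hd
    obtain ⟨i, rfl, hi⟩ := Walk.mem_support_iff_exists_getVert.1 hb
    rcases Nat.eq_zero_or_pos i with rfl | hi0
    · rw [Walk.getVert_zero] at hbd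
      have := hmax (p.length + 1) ⟨d, v, .cons hbd.symm p, hp.cons hd, by simp [hap], by simp⟩
      omega
    rcases hi.eq_or_lt with rfl | hi'
    · rw [Walk.getVert_length] at hbd
      have := hmax (p.length + 1)
        ⟨u, d, p.concat hbd, hp.concat hd hbd, by simp [Walk.support_concat, hap], by simp⟩
      omega
    have h1 := p.adj_getVert_succ hi'
    have h2 := p.adj_getVert_succ (i := i - 1) (by omega)
    rw [Nat.sub_add_cancel hi0] at h2
    rcases hdeg _ _ _ _ h1 h2.symm hbd with h | h | h
    · have := hp.getVert_injOn (by simp; omega) (by simp; omega) h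
      omega
    · exact hd (h ▸ p.getVert_mem_support _)
    · exact hd (h ▸ p.getVert_mem_support _)
  rw [reachable_iff_reflTransGen] at hab
  induction hab with
  | refl => exact hap
  | tail _ h ih => exact hclosed _ _ ih h

section LocallyInduced

variable {V N : Type*} [Fintype N] {G : SimpleGraph V} {F : SimpleGraph N} {f : N → V}

/-- The components of a graph of maximum degree at most two which is mapped to a chordal graph in a
locally induced way are parametrized by induced paths. -/
lemma Chordal.exists_parametrization (hG : G.Chordal) (hf : ∀ a b, F.Adj a b → G.Adj (f a) (f b))
    (hdeg : ∀ a b₁ b₂ b₃, F.Adj a b₁ → F.Adj a b₂ → F.Adj a b₃ → b₁ = b₂ ∨ b₁ = b₃ ∨ b₂ = b₃)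
    (hloc : ∀ a b c, F.Adj a b → F.Adj a c → b ≠ c → f b ≠ f c ∧ ¬ G.Adj (f b) (f c)) (a : N) :
    ∃ (n : ℕ) (g : ℕ → N), (∀ b, F.Reachable a b ↔ ∃ i ≤ n, g i = b) ∧
      (∀ i < n, F.Adj (g i) (g (i + 1))) ∧
      ∀ i j, i < j → j ≤ n → f (g i) ≠ f (g j) ∧ (G.Adj (f (g i)) (f (g j)) → j = i + 1) := by
  obtain ⟨u, v, p, hp, hmem⟩ := F.exists_isPath_support_of_degree_le_two hdeg a
  refine ⟨p.length, p.getVert, fun b => ?_, fun i hi => p.adj_getVert_succ hi, fun i j hij hj =>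
    hG.induced_of_locally_induced (fun i => f (p.getVert i)) p.length
      (fun i hi => hf _ _ (p.adj_getVert_succ hi)) (fun i hi => ?_) hij hj⟩
  · rw [hmem, Walk.mem_support_iff_exists_getVert]
    simp only [and_comm]
  · refine hloc _ _ _ (p.adj_getVert_succ (i := i) (by omega)).symm
      (p.adj_getVert_succ (i := i + 1) (by omega)) fun h => ?_
    have := hp.getVert_injOn (by simp; omega) (by simp; omega) h
    omega

/-- Within a component of `F`, the map to `G` is an embedding. -/
lemma Chordal.eq_and_adj_of_reachable (hG : G.Chordal)
    (hf : ∀ a b, F.Adj a b → G.Adj (f a) (f b))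
    (hdeg : ∀ a b₁ b₂ b₃, F.Adj a b₁ → F.Adj a b₂ → F.Adj a b₃ → b₁ = b₂ ∨ b₁ = b₃ ∨ b₂ = b₃)
    (hloc : ∀ a b c, F.Adj a b → F.Adj a c → b ≠ c → f b ≠ f c ∧ ¬ G.Adj (f b) (f c))
    {a b : N} (hab : F.Reachable a b) :
    (f a = f b → a = b) ∧ (G.Adj (f a) (f b) → F.Adj a b) := by
  obtain ⟨n, g, hg, hadj, hind⟩ := hG.exists_parametrization hf hdeg hloc a
  obtain ⟨i, hi, rfl⟩ := (hg a).1 (Reachable.refl a)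
  obtain ⟨j, hj, rfl⟩ := (hg b).1 hab
  rcases lt_trichotomy i j with h | rfl | h
  · refine ⟨fun he => absurd he (hind i j h hj).1, fun h' => ?_⟩
    obtain rfl := (hind i j h hj).2 h'
    exact hadj i (by omega)
  · exact ⟨fun _ => rfl, fun h => (G.loopless.irrefl _ h).elim⟩
  · refine ⟨fun he => absurd he.symm (hind j i h hi).1, fun h' => ?_⟩
    obtain rfl := (hind j i h hi).2 h'.symm
    exact (hadj j (by omega)).symm

/-- The image in `V` of a component of `F`. -/
noncomputable def componentImage [Fintype V] (f : N → V) (C : F.ConnectedComponent) : Finset V :=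
  {v | ∃ a, F.connectedComponentMk a = C ∧ f a = v}

lemma mem_componentImage [Fintype V] {C : F.ConnectedComponent} {v : V} :
    v ∈ componentImage f C ↔ ∃ a, F.connectedComponentMk a = C ∧ f a = v := by
  simp [componentImage]

lemma Chordal.isInducedPath_componentImage [Fintype V] (hG : G.Chordal)
    (hf : ∀ a b, F.Adj a b → G.Adj (f a) (f b))
    (hdeg : ∀ a b₁ b₂ b₃, F.Adj a b₁ → F.Adj a b₂ → F.Adj a b₃ → b₁ = b₂ ∨ b₁ = b₃ ∨ b₂ = b₃)
    (hloc : ∀ a b c, F.Adj a b → F.Adj a c → b ≠ c → f b ≠ f c ∧ ¬ G.Adj (f b) (f c))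
    (C : F.ConnectedComponent) : G.IsInducedPath (componentImage f C) := by
  induction C using ConnectedComponent.ind with
  | _ a =>
  obtain ⟨n, g, hg, hadj, hind⟩ := hG.exists_parametrization hf hdeg hloc a
  have hmem : ∀ v, v ∈ componentImage f (F.connectedComponentMk a) ↔ ∃ i ≤ n, f (g i) = v := by
    intro v
    rw [mem_componentImage]
    constructor
    · rintro ⟨b, hb, rfl⟩
      obtain ⟨i, hi, rfl⟩ := (hg b).1 (ConnectedComponent.exact hb).symm
      exact ⟨i, hi, rfl⟩
    · rintro ⟨i, hi, rfl⟩
      exact ⟨g i, (ConnectedComponent.sound ((hg _).2 ⟨i, hi, rfl⟩)).symm, rfl⟩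
  let e : Fin (n + 1) → (componentImage f (F.connectedComponentMk a) : Set V) :=
    fun k => ⟨f (g k), (hmem _).2 ⟨k, by omega, rfl⟩⟩
  have he : Function.Bijective e := by
    constructor
    · intro i j hij
      have hij' : f (g i) = f (g j) := congrArg Subtype.val hij
      ext
      rcases lt_trichotomy (i : ℕ) j with h | h | h
      · exact absurd hij' (hind _ _ h (by omega)).1
      · exact h
      · exact absurd hij'.symm (hind _ _ h (by omega)).1
    · rintro ⟨v, hv⟩
      obtain ⟨i, hi, rfl⟩ := (hmem v).1 hv
      exact ⟨⟨i, by omega⟩, rfl⟩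
  have hlt : ∀ i j : Fin (n + 1), i < j →
      ((pathGraph (n + 1)).Adj i j ↔ G.Adj (f (g i)) (f (g j))) := by
    intro i j hij
    have hij' : (i : ℕ) < j := hij
    rw [pathGraph_adj]
    refine ⟨fun h => ?_, fun h => Or.inl ((hind _ _ hij' (by omega)).2 h).symm⟩
    have h' : (j : ℕ) = i + 1 := by omega
    rw [h']
    exact hf _ _ (hadj _ (by omega))
  refine ⟨n + 1, by omega, ⟨RelIso.symm ⟨Equiv.ofBijective e he, ?_⟩⟩⟩
  intro i j
  rcases lt_trichotomy i j with h | rfl | h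
  · exact (hlt i j h).symm
  · simp
  · rw [SimpleGraph.adj_comm, (pathGraph _).adj_comm]
    exact (hlt j i h).symm

end LocallyInduced

/-- The graph on `X w` copies of every vertex `w` of `G` in which the two ends of the `i`-th copy of
an edge are attached to the copies of its endpoints prescribed by `c`. -/
def gluingGraph {V : Type*} (G : SimpleGraph V) (X : V → ℕ) (Y : Sym2 V → ℕ)
    (c : V → V × ℕ → ℕ) : SimpleGraph (Σ w, Fin (X w)) where
  Adj a b := G.Adj a.1 b.1 ∧
    ∃ i, i < Y s(a.1, b.1) ∧ c a.1 (b.1, i) = a.2 ∧ c b.1 (a.1, i) = b.2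
  symm := ⟨fun _ _ h => ⟨h.1.symm, by
    obtain ⟨-, i, hi, ha, hb⟩ := h
    exact ⟨i, by rwa [Sym2.eq_swap], hb, ha⟩⟩⟩
  loopless := ⟨fun _ h => G.loopless.irrefl _ h.1⟩

/-- If natural numbers `X` on vertices and `Y` on edges satisfy the inequalities of the induced path
cone of a chordal graph, some finite family of induced paths covers every vertex `v` exactly `X v`
times and every edge `e` exactly `Y e` times. -/
lemma Chordal.exists_decomposition.{u} {V : Type u} [Fintype V] {G : SimpleGraph V} (hG : G.Chordal)
    (X : V → ℕ) (Y : Sym2 V → ℕ) (hY : ∀ e, Y e ≠ 0 → e ∈ G.edgeSet)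
    (hK : ∀ (w : V) (K : Finset V), (K : Set V) ⊆ G.neighborSet w → G.IsClique (K : Set V) →
      ∑ u ∈ G.completeTo (insert w K), Y s(w, u) + 2 * ∑ u ∈ K, Y s(w, u) ≤ 2 * X w) :
    ∃ (ι : Type u) (_ : Fintype ι) (P : ι → Finset V), (∀ C, G.IsInducedPath (P C)) ∧
      (∀ v, #{C | v ∈ P C} = X v) ∧
      ∀ u v, G.Adj u v → #{C | u ∈ P C ∧ v ∈ P C} = Y s(u, v) := by
  choose c hcX hc₂ hc₃ using fun w => hG.exists_local_labelling w (fun u => Y s(w, u)) (X w)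
    (fun u hu => hY _ hu) (hK w)
  set F := gluingGraph G X Y c
  have hf : ∀ a b, F.Adj a b → G.Adj a.1 b.1 := fun a b h => h.1
  have hext : ∀ a b : Σ w, Fin (X w), a.1 = b.1 → (a.2 : ℕ) = b.2 → a = b := by
    rintro ⟨u, i⟩ ⟨v, j⟩ h h'
    dsimp only at h
    subst h
    exact congrArg _ (Fin.ext h')
  have heq : ∀ (a b b' : Σ w, Fin (X w)) (i i' : ℕ), c b.1 (a.1, i) = b.2 →
      c b'.1 (a.1, i') = b'.2 → (b.1, i) = (b'.1, i') → b = b' := by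
    intro a b b' i i' hb hb' h
    obtain ⟨h1, rfl⟩ := Prod.mk.inj h
    exact hext _ _ h1 (by rw [← hb, ← hb', h1])
  have hdeg : ∀ a b₁ b₂ b₃, F.Adj a b₁ → F.Adj a b₂ → F.Adj a b₃ →
      b₁ = b₂ ∨ b₁ = b₃ ∨ b₂ = b₃ := by
    rintro a b₁ b₂ b₃ ⟨-, i₁, hi₁, h₁, h₁'⟩ ⟨-, i₂, hi₂, h₂, h₂'⟩ ⟨-, i₃, hi₃, h₃, h₃'⟩
    rcases hc₃ a.1 (b₁.1, i₁) (b₂.1, i₂) (b₃.1, i₃) hi₁ hi₂ hi₃ (h₁.trans h₂.symm)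
      (h₁.trans h₃.symm) with h | h | h
    · exact Or.inl (heq a _ _ _ _ h₁' h₂' h)
    · exact Or.inr (Or.inl (heq a _ _ _ _ h₁' h₃' h))
    · exact Or.inr (Or.inr (heq a _ _ _ _ h₂' h₃' h))
  have hloc : ∀ a b b', F.Adj a b → F.Adj a b' → b ≠ b' → b.1 ≠ b'.1 ∧ ¬ G.Adj b.1 b'.1 := by
    rintro a b b' ⟨-, i, hi, h, h'⟩ ⟨-, j, hj, hh, hh'⟩ hne
    exact (hc₂ a.1 (b.1, i) (b'.1, j) hi hj (h.trans hh.symm)).resolve_left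
      fun he => hne (heq a _ _ _ _ h' hh' he)
  have hreach := fun a b (hab : F.Reachable a b) =>
    hG.eq_and_adj_of_reachable (f := Sigma.fst) hf hdeg hloc hab
  obtain ⟨_⟩ := nonempty_fintype F.ConnectedComponent
  refine ⟨F.ConnectedComponent, ‹_›, componentImage Sigma.fst,
    hG.isInducedPath_componentImage hf hdeg hloc, fun v => ?_, fun u v huv => ?_⟩
  · rw [← Fintype.card_fin (X v), ← card_univ]
    refine (card_bij (fun j _ => F.connectedComponentMk ⟨v, j⟩) ?_ ?_ ?_).symm
    · intro j _
      exact mem_filter.2 ⟨mem_univ _, mem_componentImage.2 ⟨⟨v, j⟩, rfl, rfl⟩⟩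
    · intro i _ j _ h
      simpa using (hreach _ _ (ConnectedComponent.exact h)).1 rfl
    · intro C hC
      obtain ⟨⟨w, j⟩, rfl, rfl⟩ := mem_componentImage.1 (mem_filter.1 hC).2
      exact ⟨j, mem_univ _, rfl⟩
  · rw [← Fintype.card_fin (Y s(u, v)), ← card_univ]
    have hadj : ∀ i : Fin (Y s(u, v)), F.Adj ⟨u, c u (v, i), hcX u (v, i) i.2⟩
        ⟨v, c v (u, i), hcX v (u, i) (by simpa only [Sym2.eq_swap (a := v)] using i.2)⟩ :=
      fun i => ⟨huv, i, i.2, rfl, rfl⟩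
    refine (card_bij (fun (i : Fin (Y s(u, v))) _ =>
      F.connectedComponentMk ⟨u, c u (v, i), hcX u (v, i) i.2⟩) ?_ ?_ ?_).symm
    · intro i _
      rw [mem_filter]
      exact ⟨mem_univ _, mem_componentImage.2 ⟨_, rfl, rfl⟩,
        mem_componentImage.2 ⟨_, (ConnectedComponent.sound (hadj i).reachable).symm, rfl⟩⟩
    · intro i _ j _ h
      have h' := (hreach _ _ (ConnectedComponent.exact h)).1 rfl
      simp only [Sigma.mk.injEq, heq_eq_eq, Fin.mk.injEq, true_and] at h'
      rcases hc₂ u _ _ i.2 j.2 h' with h | h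
      · exact Fin.ext (Prod.mk.inj h).2
      · exact absurd rfl h.1
    · intro C hC
      obtain ⟨hu, hv⟩ := (mem_filter.1 hC).2
      obtain ⟨a, rfl, rfl⟩ := mem_componentImage.1 hu
      obtain ⟨b, hb, rfl⟩ := mem_componentImage.1 hv
      obtain ⟨-, i, hi, ha, -⟩ := (hreach _ _ (ConnectedComponent.exact hb).symm).2 huv
      exact ⟨⟨i, hi⟩, mem_univ _, congrArg _ (hext _ _ rfl ha)⟩

end SimpleGraph

/-- in a chordal graph, the extended incidence vectors of induced paths
form a Hilbert basis of the induced path cone `C_P(G)`. -/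
theorem inducedPaths_form_hilbert_basis {V : Type*} [Fintype V]
    (G : SimpleGraph V) (hG : G.Chordal)
    (p : (V → ℝ) × (Sym2 V → ℝ)) (hp : p ∈ G.inducedPathCone)
    (hx : ∀ v, ∃ n : ℤ, p.1 v = n) (hy : ∀ e, ∃ n : ℤ, p.2 e = n) :
    ∃ lam : Finset V → ℕ, (∀ W, lam W ≠ 0 → G.IsInducedPath W) ∧
      p = ∑ W : Finset V, (lam W : ℝ) • G.xi W := by
  obtain ⟨hx0, hy0, hyE, hK⟩ := hp
  have hX : ∀ v, ∃ n : ℕ, p.1 v = n := fun v => by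
    obtain ⟨n, hn⟩ := hx v
    lift n to ℕ using by have := hx0 v; rw [hn] at this; exact_mod_cast this
    exact ⟨n, by exact_mod_cast hn⟩
  have hY : ∀ e, ∃ n : ℕ, p.2 e = n := fun e => by
    obtain ⟨n, hn⟩ := hy e
    lift n to ℕ using by have := hy0 e; rw [hn] at this; exact_mod_cast this
    exact ⟨n, by exact_mod_cast hn⟩
  choose X hX using hX
  choose Y hY using hY
  obtain ⟨ι, _, P, hP, hPX, hPY⟩ := hG.exists_decomposition X Y
    (fun e he => by
      by_contra h
      have := hyE e h
      rw [hY] at this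
      exact he (by exact_mod_cast this))
    (fun w K hw hc => by
      have := hK w K hw hc
      simp only [hX, hY] at this
      exact_mod_cast this)
  refine ⟨fun W => #{C | P C = W}, fun W hW => ?_, ?_⟩
  · obtain ⟨C, hC⟩ := card_pos.1 (Nat.pos_of_ne_zero hW)
    rw [← (mem_filter.1 hC).2]
    exact hP C
  have hsum : ∑ W : Finset V, ((#{C | P C = W} : ℕ) : ℝ) • G.xi W = ∑ C, G.xi (P C) := by
    rw [← sum_fiberwise univ P]
    refine sum_congr rfl fun W _ => ?_
    rw [sum_congr rfl fun C hC => by rw [(mem_filter.1 hC).2], sum_const, Nat.cast_smul_eq_nsmul]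
  rw [hsum]
  refine Prod.ext (funext fun v => ?_) (funext fun e => ?_)
  · rw [hX, ← hPX, Prod.fst_sum, Finset.sum_apply]
    simp [xi]
  · rw [hY, Prod.snd_sum, Finset.sum_apply]
    induction e using Sym2.ind with
    | _ u v =>
    by_cases huv : G.Adj u v
    · rw [← hPY u v huv]
      simp [xi, huv]
    · have : (Y s(u, v) : ℝ) = 0 := by rw [← hY]; exact hyE _ huv
      simp [xi, huv, this]
end
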